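/- arXiv:1610.02075 — 10 statements merged into one kernel-verified Lean document; each statement's English description precedes it below -/
import Mathlib

section
/- Let K be a field. Let φ be the K-algebra homomorphism from the polynomial ring K[y_{ij} : i, j ∈ ℕ, i > j] to the polynomial ring K[x_i : i ∈ ℕ] determined by φ(y_{ij}) = x_i·x_j. Then, writing y_{ij} = y_{ji} whenever i < j, the kernel of φ is the ideal generated by all polynomials y_{ij}·y_{kl} − y_{il}·y_{kj} where i, j, k, l are pairwise distinct natural numbers (the 2×2 minors not containing diagonal entries of the symmetric matrix (y_{ij})). -/
open MvPolynomial

/-- For distinct `i j : ℕ`, the variable `y_{ij}` of the polynomial ring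
`K[y_{ij} : i > j]`, with the convention `y_{ij} = y_{ji}`. -/
noncomputable def Yvar (K : Type*) [Field K] (i j : ℕ) (h : i ≠ j) :
    MvPolynomial {p : ℕ × ℕ // p.1 > p.2} K :=
  X ⟨(max i j, min i j), min_lt_max.mpr h⟩

/-- `MonOf Y d m`: `m` is a product of variables `Y a b` (`a ≠ b`) with vertex multiset `d`. -/
inductive MonOf {A : Type*} [CommRing A] (Y : ℕ → ℕ → A) : Multiset ℕ → A → Prop
  | zero : MonOf Y 0 1
  | cons (a b : ℕ) (d : Multiset ℕ) (m : A) (h : a ≠ b) (hm : MonOf Y d m) :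
      MonOf Y (a ::ₘ b ::ₘ d) (Y a b * m)

section core
variable {A : Type*} [CommRing A] {Y : ℕ → ℕ → A}

theorem MonOf.extract (hsymm : ∀ i j, Y i j = Y j i) {d : Multiset ℕ} {m : A}
    (h : MonOf Y d m) (x : ℕ) (hx : x ∈ d) :
    ∃ y d' m', x ≠ y ∧ d = x ::ₘ y ::ₘ d' ∧ m = Y x y * m' ∧ MonOf Y d' m' := by
  induction h with
  | zero => simp at hx
  | cons a b d m hab hm ih =>
    by_cases hxa : x = a
    · subst hxa
      exact ⟨b, d, m, hab, rfl, rfl, hm⟩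
    by_cases hxb : x = b
    · subst hxb
      exact ⟨a, d, m, hxa, Multiset.cons_swap _ _ _, by rw [hsymm], hm⟩
    have hxd : x ∈ d := by simpa [hxa, hxb] using hx
    obtain ⟨y, d', m', hxy, rfl, rfl, hm'⟩ := ih hxd
    refine ⟨y, a ::ₘ b ::ₘ d', Y a b * m', hxy, ?_, by ring, .cons _ _ _ _ hab hm'⟩
    simp only [← Multiset.singleton_add]
    abel

theorem MonOf.count_le {d : Multiset ℕ} {m : A} (h : MonOf Y d m) (c : ℕ) :
    2 * d.count c ≤ d.card := by
  induction h with
  | zero => simp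
  | cons a b d m hab hm ih =>
    simp only [Multiset.count_cons, Multiset.card_cons]
    split_ifs <;> omega

theorem MonOf.avoid {d : Multiset ℕ} {m : A}
    (h : MonOf Y d m) (c : ℕ) (hc : 2 * d.count c < d.card) :
    ∃ u v d' m', u ≠ c ∧ v ≠ c ∧ u ≠ v ∧ d = u ::ₘ v ::ₘ d' ∧ m = Y u v * m' ∧
      MonOf Y d' m' := by
  induction h with
  | zero => simp at hc
  | cons a b d m hab hm ih =>
    by_cases h : a ≠ c ∧ b ≠ c
    · exact ⟨a, b, d, m, h.1, h.2, hab, rfl, rfl, hm⟩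
    have : 2 * d.count c < d.card := by
      simp only [Multiset.count_cons, Multiset.card_cons] at hc
      split_ifs at hc <;> omega
    obtain ⟨u, v, d', m', h1, h2, h3, rfl, rfl, hm'⟩ := ih this
    refine ⟨u, v, a ::ₘ b ::ₘ d', Y a b * m', h1, h2, h3, ?_, by ring, .cons _ _ _ _ hab hm'⟩
    simp only [← Multiset.singleton_add]
    abel

theorem MonOf.congr {d d' : Multiset ℕ} {m m' : A} (h : MonOf Y d m) (hd : d = d')
    (hm : m = m') : MonOf Y d' m' := by subst hd hm; exact h

theorem MonOf.mul {d d' : Multiset ℕ} {m m' : A} (h : MonOf Y d m) (h' : MonOf Y d' m') :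
    MonOf Y (d + d') (m * m') := by
  induction h with
  | zero => simpa using h'
  | cons a b d m hab hm ih =>
    exact (MonOf.cons a b _ _ hab ih).congr (by simp) (by ring)

theorem MonOf.key (hsymm : ∀ i j, Y i j = Y j i)
    (hsw : ∀ i j k l, i ≠ j → k ≠ l → i ≠ l → k ≠ j → i ≠ k → j ≠ l →
      Y i j * Y k l = Y i l * Y k j)
    {d e : Multiset ℕ} {m : A} (h : MonOf Y d m) (a b : ℕ) (hab : a ≠ b)
    (hd : d = a ::ₘ b ::ₘ e) (he : ∀ c, 2 * e.count c ≤ e.card) :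
    ∃ m'', MonOf Y e m'' ∧ m = Y a b * m'' := by
  obtain ⟨c, d1, m1, hac, hd1, rfl, h1⟩ := h.extract hsymm a (by simp [hd])
  rw [hd, Multiset.cons_inj_right] at hd1
  by_cases hcb : c = b
  · subst hcb
    rw [Multiset.cons_inj_right] at hd1
    subst hd1
    exact ⟨m1, h1, rfl⟩
  have hb : b ∈ d1 := by
    have : b ∈ c ::ₘ d1 := by rw [← hd1]; simp
    simpa [Ne.symm hcb] using this
  obtain ⟨f, d2, m2, hbf, rfl, rfl, h2⟩ := h1.extract hsymm b hb
  rw [Multiset.cons_swap, Multiset.cons_inj_right] at hd1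
  subst hd1
  by_cases hfa : f = a
  · subst hfa
    exact ⟨Y f c * m2, (MonOf.cons f c _ _ hac h2).congr (Multiset.cons_swap _ _ _) rfl,
      by rw [hsymm b f]; ring⟩
  by_cases hfc : f = c
  swap
  · refine ⟨Y c f * m2, MonOf.cons _ _ _ _ (Ne.symm hfc) h2, ?_⟩
    have := hsw a c f b hac (Ne.symm hbf) hab hfc (Ne.symm hfa) hcb
    rw [hsymm b f, ← mul_assoc, this, hsymm f c]; ring
  subst hfc
  have hlt : 2 * d2.count f < d2.card := by
    have := he f
    simp only [Multiset.count_cons, Multiset.card_cons, if_true] at this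
    omega
  obtain ⟨u, v, d3, m3, huc, hvc, huv, rfl, rfl, h3⟩ := h2.avoid f hlt
  -- a special case: the avoiding edge contains `a` or `b`
  have spec : ∀ p q v, p ≠ q → p ≠ f → q ≠ f → v ≠ f → p ≠ v →
      ∃ m'', MonOf Y (f ::ₘ f ::ₘ p ::ₘ v ::ₘ d3) m'' ∧
        Y p f * (Y q f * (Y p v * m3)) = Y p q * m'' := by
    intro p q v hpq hpf hqf hvf hpv
    by_cases hvq : v = q
    · subst hvq
      refine ⟨Y p f * (Y v f * m3), (MonOf.cons p f _ _ hpf (MonOf.cons v f _ _ hvf h3)).congr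
        ?_ rfl, by ring⟩
      simp only [← Multiset.singleton_add]
      abel
    · refine ⟨Y p f * (Y f v * m3),
        (MonOf.cons p f _ _ hpf (MonOf.cons f v _ _ (Ne.symm hvf) h3)).congr ?_ rfl, ?_⟩
      · simp only [← Multiset.singleton_add]
        abel
      · have := hsw p v f q hpv (Ne.symm hqf) hpq (Ne.symm hvf) hpf hvq
        rw [hsymm q f]
        linear_combination (Y p f * m3) * this
  by_cases hua : u = a
  · subst hua
    exact spec u b v hab hac hbf hvc huv
  by_cases hva : v = a
  · subst hva
    obtain ⟨m'', hm, e⟩ := spec v b u hab hac hbf huc huv.symm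
    refine ⟨m'', hm.congr ?_ rfl, by rw [← e, hsymm u v]⟩
    rw [Multiset.cons_swap v u]
  by_cases hub : u = b
  · subst hub
    obtain ⟨m'', hm, e⟩ := spec u a v hab.symm hbf hac hvc huv
    exact ⟨m'', hm, by rw [hsymm a u, ← e]; ring⟩
  by_cases hvb : v = b
  · subst hvb
    obtain ⟨m'', hm, e⟩ := spec v a u hab.symm hbf hac huc huv.symm
    refine ⟨m'', hm.congr ?_ rfl, by rw [hsymm a v, ← e, hsymm u v]; ring⟩
    rw [Multiset.cons_swap v u]
  refine ⟨Y f v * (Y f u * m3),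
    (MonOf.cons f v _ _ hvc.symm (MonOf.cons f u _ _ huc.symm h3)).congr ?_ rfl, ?_⟩
  · simp only [← Multiset.singleton_add]
    abel
  · have e1 := hsw a f v u hac huv.symm (Ne.symm hua) hvc (Ne.symm hva) huc.symm
    have e2 := hsw a u f b (Ne.symm hua) hbf.symm hab huc.symm hac hub
    rw [hsymm b f, hsymm u v]
    rw [hsymm v f] at e1
    linear_combination (Y f b * m3) * e1 + (Y f v * m3) * e2

theorem MonOf.unique (hsymm : ∀ i j, Y i j = Y j i)
    (hsw : ∀ i j k l, i ≠ j → k ≠ l → i ≠ l → k ≠ j → i ≠ k → j ≠ l →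
      Y i j * Y k l = Y i l * Y k j)
    {d : Multiset ℕ} {m m' : A} (h' : MonOf Y d m') (h : MonOf Y d m) : m = m' := by
  induction h' generalizing m with
  | zero =>
    generalize hd : (0 : Multiset ℕ) = d at h
    cases h with
    | zero => rfl
    | cons a b d m hab hm => simp at hd
  | cons a b e n hab hn ih =>
    obtain ⟨m'', hm, rfl⟩ := h.key hsymm hsw a b hab rfl hn.count_le
    rw [ih hm]

end core

theorem Yvar_comm (K : Type*) [Field K] (i j : ℕ) (h : i ≠ j) :
    Yvar K i j h = Yvar K j i h.symm := by
  unfold Yvar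
  congr 3
  · exact max_comm _ _
  · exact min_comm _ _

theorem prod_map_X_eq (K : Type*) [Field K] (d : Multiset ℕ) :
    (d.map (fun i => (X i : MvPolynomial ℕ K))).prod = monomial (Multiset.toFinsupp d) 1 := by
  induction d using Multiset.induction_on with
  | empty => simp
  | cons a s ih =>
    rw [Multiset.map_cons, Multiset.prod_cons, ih, ← Multiset.singleton_add, map_add,
      Multiset.toFinsupp_singleton, X, monomial_mul, one_mul]

/-- The kernel of the `K`-algebra map `K[y_{ij} : i > j] → K[x_i : i ∈ ℕ]`,
`y_{ij} ↦ x_i·x_j`, is generated by the off-diagonal `2×2` minors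
`y_{ij}·y_{kl} − y_{il}·y_{kj}` for pairwise distinct `i, j, k, l`. -/
theorem kernel_eq_span_minors (K : Type*) [Field K] :
    RingHom.ker (aeval (fun p : {p : ℕ × ℕ // p.1 > p.2} => X p.val.1 * X p.val.2 :
        {p : ℕ × ℕ // p.1 > p.2} → MvPolynomial ℕ K)).toRingHom =
      Ideal.span {f : MvPolynomial {p : ℕ × ℕ // p.1 > p.2} K |
        ∃ (i j k l : ℕ) (hij : i ≠ j) (hkl : k ≠ l) (hil : i ≠ l) (hkj : k ≠ j)
          (_ : i ≠ k) (_ : j ≠ l),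
          f = Yvar K i j hij * Yvar K k l hkl - Yvar K i l hil * Yvar K k j hkj} := by
  set φ := (aeval (R := K) (fun p : {p : ℕ × ℕ // p.1 > p.2} => X p.val.1 * X p.val.2 :
        {p : ℕ × ℕ // p.1 > p.2} → MvPolynomial ℕ K)) with hφ
  set I := Ideal.span {f : MvPolynomial {p : ℕ × ℕ // p.1 > p.2} K |
        ∃ (i j k l : ℕ) (hij : i ≠ j) (hkl : k ≠ l) (hil : i ≠ l) (hkj : k ≠ j)
          (_ : i ≠ k) (_ : j ≠ l),
          f = Yvar K i j hij * Yvar K k l hkl - Yvar K i l hil * Yvar K k j hkj} with hI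
  have hφY : ∀ i j h, φ (Yvar K i j h) = X i * X j := by
    intro i j h
    simp only [hφ, Yvar, aeval_X]
    rcases le_total i j with h | h
    · rw [max_eq_right h, min_eq_left h, mul_comm]
    · rw [max_eq_left h, min_eq_right h]
  apply le_antisymm
  swap
  · rw [hI, Ideal.span_le]
    rintro f ⟨i, j, k, l, hij, hkl, hil, hkj, -, -, rfl⟩
    change φ _ = 0
    rw [map_sub, map_mul, map_mul, hφY, hφY, hφY, hφY]
    ring
  · let Y : ℕ → ℕ → (MvPolynomial {p : ℕ × ℕ // p.1 > p.2} K ⧸ I) := fun i j =>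
      if h : i ≠ j then Ideal.Quotient.mk I (Yvar K i j h) else 0
    have hsymm : ∀ i j, Y i j = Y j i := by
      intro i j
      by_cases h : i = j
      · rw [h]
      · simp only [Y]
        rw [dif_pos h, dif_pos (Ne.symm h), Yvar_comm]
    have hsw : ∀ i j k l, i ≠ j → k ≠ l → i ≠ l → k ≠ j → i ≠ k → j ≠ l →
        Y i j * Y k l = Y i l * Y k j := by
      intro i j k l h1 h2 h3 h4 h5 h6
      simp only [Y]
      rw [dif_pos h1, dif_pos h2, dif_pos h3, dif_pos h4, ← map_mul, ← map_mul,
        Ideal.Quotient.eq]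
      exact Ideal.subset_span ⟨i, j, k, l, h1, h2, h3, h4, h5, h6, rfl⟩
    have hmon : ∀ m : {p : ℕ × ℕ // p.1 > p.2} →₀ ℕ, ∃ d : Multiset ℕ,
        MonOf Y d (Ideal.Quotient.mk I (monomial m 1)) ∧
          φ (monomial m 1) = monomial (Multiset.toFinsupp d) 1 := by
      have hmul : ∀ f g : MvPolynomial {p : ℕ × ℕ // p.1 > p.2} K,
          (∃ d : Multiset ℕ, MonOf Y d (Ideal.Quotient.mk I f) ∧
            φ f = monomial (Multiset.toFinsupp d) 1) →
          (∃ d : Multiset ℕ, MonOf Y d (Ideal.Quotient.mk I g) ∧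
            φ g = monomial (Multiset.toFinsupp d) 1) →
          (∃ d : Multiset ℕ, MonOf Y d (Ideal.Quotient.mk I (f * g)) ∧
            φ (f * g) = monomial (Multiset.toFinsupp d) 1) := by
        rintro f g ⟨d, h1, h2⟩ ⟨d', h1', h2'⟩
        refine ⟨d + d', ?_, ?_⟩
        · rw [map_mul]; exact h1.mul h1'
        · rw [map_mul, h2, h2', monomial_mul, one_mul, map_add]
      have hone : ∃ d : Multiset ℕ, MonOf Y d (Ideal.Quotient.mk I 1) ∧
            φ 1 = monomial (Multiset.toFinsupp d) 1 :=
        ⟨0, by rw [map_one]; exact .zero, by simp⟩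
      intro m
      induction m using Finsupp.induction_linear with
      | zero => exact hone
      | add f g hf hg =>
        have := hmul _ _ hf hg
        rwa [monomial_mul, one_mul] at this
      | single p n =>
        rw [← X_pow_eq_monomial]
        induction n with
        | zero => rw [pow_zero]; exact hone
        | succ n ih =>
          rw [pow_succ]
          refine hmul _ _ ih ⟨p.1.1 ::ₘ p.1.2 ::ₘ 0, ?_, ?_⟩
          · refine (MonOf.cons p.1.1 p.1.2 0 1 (ne_of_gt p.2) .zero).congr rfl ?_
            simp only [Y]
            rw [dif_pos (ne_of_gt p.2), mul_one]
            congr 1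
            unfold Yvar
            congr 1
            apply Subtype.ext
            exact Prod.ext (max_eq_left (le_of_lt p.2)) (min_eq_right (le_of_lt p.2))
          · rw [← prod_map_X_eq]
            simp [hφ]
    choose D hD1 hD2 using hmon
    classical
    let s : MvPolynomial ℕ K →ₗ[K] (MvPolynomial {p : ℕ × ℕ // p.1 > p.2} K ⧸ I) :=
      (MvPolynomial.basisMonomials ℕ K).constr K (fun d =>
        if h : ∃ m, Multiset.toFinsupp (D m) = d then
          Ideal.Quotient.mk I (monomial h.choose 1) else 0)
    have hs : s ∘ₗ φ.toLinearMap = (Ideal.Quotient.mkₐ K I).toLinearMap := by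
      apply (MvPolynomial.basisMonomials _ K).ext
      intro m
      have hex : ∃ m', Multiset.toFinsupp (D m') = Multiset.toFinsupp (D m) := ⟨m, rfl⟩
      have h1 : s (monomial (Multiset.toFinsupp (D m)) 1) =
          Ideal.Quotient.mk I (monomial hex.choose 1) := by
        have := (MvPolynomial.basisMonomials ℕ K).constr_basis K (fun d =>
          if h : ∃ m, Multiset.toFinsupp (D m) = d then
            Ideal.Quotient.mk I (monomial h.choose 1) else 0) (Multiset.toFinsupp (D m))
        rw [dif_pos hex, coe_basisMonomials] at this
        exact this
      rw [coe_basisMonomials]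
      change s (φ (monomial m 1)) = Ideal.Quotient.mk I (monomial m 1)
      rw [hD2, h1]
      have h2 : D hex.choose = D m := Multiset.toFinsupp.injective hex.choose_spec
      exact MonOf.unique hsymm hsw (hD1 m) ((hD1 hex.choose).congr h2 rfl)
    intro f hf
    have hf0 : φ f = 0 := hf
    have := LinearMap.congr_fun hs f
    change s (φ f) = Ideal.Quotient.mk I f at this
    rw [hf0, map_zero] at this
    exact Ideal.Quotient.eq_zero_iff_mem.mp this.symm
end

section
/- Let K be a field. For each n ≥ 2, let I_n be the kernel of the K-algebra homomorphism K[y_{ij} : 1 ≤ i ≠ j ≤ n] → K[x_1, …, x_n] determined by y_{ij} ↦ x_i²·x_j. Then the chain I_2 ⊆ I_3 ⊆ ⋯ stabilizes up to the symmetric group: there exist N ≥ 2 and a finite subset G ⊆ I_N such that for every m ≥ N, the ideal I_m is generated by the images of the elements of G under all ring homomorphisms K[y_{ij} : 1 ≤ i ≠ j ≤ N] → K[y_{ij} : 1 ≤ i ≠ j ≤ m] of the form y_{ij} ↦ y_{π(i)π(j)} for injective maps π : {1, …, N} → {1, …, m}. -/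
open MvPolynomial

/-- The index set of the variables `y_{ij}`, `i ≠ j`, of `K[y_{ij} : 1 ≤ i ≠ j ≤ n]`. -/
def OffDiag (n : ℕ) : Type := {p : Fin n × Fin n // p.1 ≠ p.2}

/-- The toric ideal `I_n`, the kernel of `K[y_{ij}] → K[x_1,…,x_n]`,
`y_{ij} ↦ x_i²·x_j`. -/
noncomputable def toricIdeal (K : Type*) [Field K] (n : ℕ) :
    Ideal (MvPolynomial (OffDiag n) K) :=
  RingHom.ker (aeval (fun p : OffDiag n => X p.val.1 ^ 2 * X p.val.2 :
    OffDiag n → MvPolynomial (Fin n) K)).toRingHom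

/-- The map on variable indices `y_{ij} ↦ y_{π(i)π(j)}` induced by an injective
map `π : {1,…,n} → {1,…,m}`. -/
def offDiagMap {n m : ℕ} (π : Fin n → Fin m) (hπ : Function.Injective π) :
    OffDiag n → OffDiag m :=
  fun p => ⟨(π p.val.1, π p.val.2), fun h => p.prop (hπ h)⟩


noncomputable section ToricAux

open Classical in
/-- contribution of the edge `p` to the weight of `v` -/
def edgeWt {m : ℕ} (v : Fin m) (p : OffDiag m) : ℕ :=
  2 * (if p.val.1 = v then 1 else 0) + (if p.val.2 = v then 1 else 0)

def wt {m : ℕ} (S : Multiset (OffDiag m)) (v : Fin m) : ℕ := (S.map (edgeWt v)).sum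

theorem wt_zero {m : ℕ} (v : Fin m) : wt (0 : Multiset (OffDiag m)) v = 0 := by simp [wt]

theorem wt_cons {m : ℕ} (p : OffDiag m) (S : Multiset (OffDiag m)) (v : Fin m) :
    wt (p ::ₘ S) v = edgeWt v p + wt S v := by simp [wt]

theorem wt_add {m : ℕ} (R S : Multiset (OffDiag m)) (v : Fin m) :
    wt (R + S) v = wt R v + wt S v := by simp [wt]

theorem edgeWt_le {m : ℕ} (v : Fin m) (p : OffDiag m) : edgeWt v p ≤ 2 := by
  have := p.prop
  unfold edgeWt
  split_ifs with h1 h2 <;> simp_all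

theorem sum_mono_le {α : Type*} (f : α → ℕ) {S A : Multiset α} (h : S ≤ A) :
    (S.map f).sum ≤ (A.map f).sum := by
  obtain ⟨R, rfl⟩ := Multiset.le_iff_exists_add.1 h
  simp

theorem wt_mono {m : ℕ} {S A : Multiset (OffDiag m)} (h : S ≤ A) (v : Fin m) :
    wt S v ≤ wt A v := sum_mono_le _ h

theorem wt_def {m : ℕ} (S : Multiset (OffDiag m)) (v : Fin m) :
    wt S v + (S.map (fun p => 2 - edgeWt v p)).sum = 2 * Multiset.card S := by
  induction S using Multiset.induction_on with
  | empty => simp [wt]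
  | cons p S ih =>
    have := edgeWt_le v p
    simp only [wt_cons, Multiset.map_cons, Multiset.sum_cons, Multiset.card_cons]
    omega

theorem wt_sum {m : ℕ} (S : Multiset (OffDiag m)) : ∑ v, wt S v = 3 * Multiset.card S := by
  induction S using Multiset.induction_on with
  | empty => simp [wt]
  | cons p S ih =>
    simp only [wt_cons, Multiset.card_cons, Finset.sum_add_distrib, ih, edgeWt,
      ← Finset.mul_sum]
    simp
    ring

/-- number of odd-valued vertices -/
def oddN {m : ℕ} (w : Fin m → ℕ) : ℕ := (Finset.univ.filter (fun v => w v % 2 = 1)).card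

theorem oddN_congr {m : ℕ} {w w' : Fin m → ℕ} (h : ∀ v, w v % 2 = w' v % 2) :
    oddN w = oddN w' := by
  unfold oddN; simp only [h]

theorem oddN_flip {m : ℕ} {w w' : Fin m → ℕ} (c : Fin m)
    (h : ∀ v, v ≠ c → w v % 2 = w' v % 2) : oddN w ≤ oddN w' + 1 := by
  unfold oddN
  refine le_trans (Finset.card_le_card (t := insert c
    (Finset.univ.filter (fun v => w' v % 2 = 1))) ?_) (Finset.card_insert_le _ _)
  intro v hv
  by_cases hc : v = c
  · simp [hc]
  · have := h v hc
    simp_all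

theorem oddN_drop {m : ℕ} {w w' : Fin m → ℕ} (c : Fin m)
    (h : ∀ v, v ≠ c → w v % 2 = w' v % 2) (h1 : w c % 2 = 0) (h2 : w' c % 2 = 1) :
    oddN w + 1 = oddN w' := by
  unfold oddN
  rw [← Finset.card_insert_of_notMem (a := c) (by simp [h1])]
  congr 1
  ext v
  by_cases hc : v = c
  · simp [hc, h2]
  · have := h v hc
    simp_all

theorem oddN_wt {m : ℕ} (S : Multiset (OffDiag m)) : oddN (wt S) ≤ Multiset.card S := by
  induction S using Multiset.induction_on with
  | empty => simp [wt, oddN]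
  | cons p S ih =>
    rw [Multiset.card_cons]
    refine le_trans (oddN_flip (w' := wt S) p.val.2 ?_) (by omega)
    intro v hv
    rw [wt_cons, edgeWt, if_neg hv.symm]
    omega

theorem two_le_sum {m : ℕ} (w : Fin m → ℕ) {a b : Fin m} (h : a ≠ b) :
    w a + w b ≤ ∑ v, w v := by
  rw [← Finset.sum_pair h]
  exact Finset.sum_le_sum_of_subset (Finset.subset_univ _)

theorem three_le_sum {m : ℕ} (w : Fin m → ℕ) {a b c : Fin m} (h : a ≠ b) (h1 : a ≠ c)
    (h2 : b ≠ c) : w a + w b + w c ≤ ∑ v, w v := by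
  have : ∑ v ∈ ({a, b, c} : Finset (Fin m)), w v = w a + w b + w c := by
    rw [Finset.sum_insert (by simp [h, h1]), Finset.sum_pair h2]; ring
  rw [← this]
  exact Finset.sum_le_sum_of_subset (Finset.subset_univ _)

structure Feas {m : ℕ} (w : Fin m → ℕ) (k : ℕ) : Prop where
  sum : ∑ v, w v = 3 * k
  le : ∀ v, w v ≤ 2 * k
  odd : oddN w ≤ k

structure Choice {m : ℕ} (w : Fin m → ℕ) (a b : Fin m) : Prop where
  ne : a ≠ b
  max : ∀ v, w v ≤ w a
  two : 2 ≤ w a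
  one : 1 ≤ w b
  par : w b % 2 = 1 ∨ ∀ v, v ≠ a → w v % 2 = 0

theorem feas_wt {m : ℕ} (S : Multiset (OffDiag m)) : Feas (wt S) (Multiset.card S) :=
  ⟨wt_sum S, fun v => by have := wt_def S v; omega, oddN_wt S⟩

theorem exists_choice {m : ℕ} {w : Fin m → ℕ} {k : ℕ} (hk : 1 ≤ k) (h : Feas w k) :
    ∃ a b, Choice w a b := by
  have hne : (Finset.univ : Finset (Fin m)).Nonempty := by
    by_contra hc
    have := h.sum
    rw [Finset.not_nonempty_iff_eq_empty.1 hc] at this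
    simp at this
    omega
  obtain ⟨a, -, ha⟩ := Finset.exists_max_image Finset.univ w hne
  have hmax : ∀ v, w v ≤ w a := fun v => ha v (Finset.mem_univ v)
  have htwo : 2 ≤ w a := by
    by_contra hc
    have h1 : ∑ v, w v ≤ oddN w := by
      unfold oddN
      rw [Finset.card_filter]
      refine Finset.sum_le_sum fun v _ => ?_
      have := hmax v
      split_ifs <;> omega
    have := h.sum
    have := h.odd
    omega
  by_cases hb : ∃ b, b ≠ a ∧ w b % 2 = 1
  · obtain ⟨b, hb, hb'⟩ := hb
    exact ⟨a, b, hb.symm, hmax, htwo, by omega, Or.inl hb'⟩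
  · push Not at hb
    have : ∃ b, b ≠ a ∧ 1 ≤ w b := by
      by_contra hc
      push Not at hc
      have h1 : ∑ v, w v = w a := Finset.sum_eq_single a
        (fun v _ hv => by have := hc v hv; omega) (by simp)
      have := h.sum
      have := h.le a
      omega
    obtain ⟨b, hb1, hb2⟩ := this
    exact ⟨a, b, hb1.symm, hmax, htwo, hb2, Or.inr fun v hv => by have := hb v hv; omega⟩

def mkE {m : ℕ} {a b : Fin m} (h : a ≠ b) : OffDiag m := ⟨(a, b), h⟩

theorem edgeWt_mkE {m : ℕ} {a b : Fin m} (h : a ≠ b) (v : Fin m) :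
    edgeWt v (mkE h) = if v = a then 2 else if v = b then 1 else 0 := by
  unfold edgeWt mkE
  by_cases h1 : v = a
  · subst h1; simp [h.symm]
  · by_cases h2 : v = b
    · subst h2; simp [h, h.symm]
    · simp [h1, h2, Ne.symm h1, Ne.symm h2]

theorem sum_sub {m : ℕ} {w : Fin m → ℕ} {p : OffDiag m} {k : ℕ}
    (hs : ∑ v, w v = 3 * (k + 1)) (hle : ∀ v, edgeWt v p ≤ w v) :
    ∑ v, (w v - edgeWt v p) = 3 * k := by
  have h1 : ∑ v, edgeWt v p = 3 := by
    have := wt_sum (p ::ₘ 0)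
    simp only [wt_cons, wt_zero, add_zero, Multiset.card_cons, Multiset.card_zero] at this
    omega
  have h2 : ∑ v, (w v - edgeWt v p) + ∑ v, edgeWt v p = ∑ v, w v := by
    rw [← Finset.sum_add_distrib]
    exact Finset.sum_congr rfl fun v _ => by have := hle v; omega
  omega

theorem exists_real {m : ℕ} (k : ℕ) : ∀ w : Fin m → ℕ, Feas w k →
    ∃ T : Multiset (OffDiag m), wt T = w := by
  induction k with
  | zero =>
    intro w h
    exact ⟨0, funext fun v => by have := h.le v; rw [wt_zero]; omega⟩
  | succ k ih =>
    intro w h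
    obtain ⟨a, b, hc⟩ := exists_choice (by omega) h
    have hval := edgeWt_mkE hc.ne
    have hle : ∀ v, edgeWt v (mkE hc.ne) ≤ w v := by
      intro v
      rw [hval]
      have h1 := hc.two
      have h2 := hc.one
      split_ifs with e1 e2
      · subst e1; exact h1
      · subst e2; exact h2
      · omega
    have hab := hc.ne
    obtain ⟨T, hT⟩ := ih (fun v => w v - edgeWt v (mkE hc.ne)) ⟨sum_sub h.sum hle, by
      intro v
      have h1 := h.le v
      have h2 := h.sum
      have h3 := hc.max v
      have h4 := hc.one
      have h5 := hc.two
      simp only [hval]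
      split_ifs with e1 e2
      · omega
      · subst e2
        have := two_le_sum w hab
        omega
      · have := three_le_sum w hab (Ne.symm e1) (Ne.symm e2)
        omega, by
      rcases hc.par with hp | hp
      · have := oddN_drop (w := fun v => w v - edgeWt v (mkE hc.ne)) (w' := w) b
          (fun v hv => by
            have := hle v
            simp only [hval, if_neg hv] at *
            split_ifs at * <;> omega)
          (by
            have := hc.one
            simp only [hval, if_neg hab.symm, if_true]; omega) hp
        have := h.odd
        omega
      · have hpar : (oddN w) % 2 = (k + 1) % 2 := by
          have : (∑ v, w v) % 2 = oddN w % 2 := by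
            unfold oddN
            rw [Finset.card_filter, Finset.sum_nat_mod]
            congr 1
            refine Finset.sum_congr rfl fun v _ => ?_
            split_ifs <;> omega
          rw [h.sum] at this
          omega
        have h1 : oddN w ≤ 1 := by
          unfold oddN
          refine Finset.card_le_one.2 ?_
          have : ∀ v, v ∈ Finset.univ.filter (fun v => w v % 2 = 1) → v = a := by
            intro v hv
            by_contra hva
            have := hp v hva
            simp at hv
            omega
          intro x hx y hy
          rw [this x hx, this y hy]
        have h2 := oddN_flip (w := fun v => w v - edgeWt v (mkE hc.ne)) (w' := w) b
          (fun v hv => by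
            have := hle v
            simp only [hval, if_neg hv] at *
            split_ifs at * <;> omega)
        rcases Nat.lt_or_ge 1 k with hk | hk
        · omega
        · rcases Nat.lt_or_ge 0 k with hk0 | hk0
          · omega
          · exfalso
            have hk : k = 0 := by omega
            subst hk
            have h3 := h.le a
            have h4 := hc.two
            have h5 := hp b hab.symm
            have h6 := hc.one
            have h7 := two_le_sum w hab
            have h8 := h.sum
            omega⟩
    refine ⟨mkE hc.ne ::ₘ T, funext fun v => ?_⟩
    rw [wt_cons, hT]
    have := hle v
    simp only
    omega

theorem exists_sub {α : Type*} (f : α → ℕ) (A : Multiset α) : ∀ c : ℕ, c ≤ (A.map f).sum →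
    ∃ D ≤ A, Multiset.card D ≤ c ∧ c ≤ (D.map f).sum := by
  induction A using Multiset.induction_on with
  | empty => intro c hc; exact ⟨0, le_rfl, by simp, hc⟩
  | cons p A ih =>
    intro c hc
    rw [Multiset.map_cons, Multiset.sum_cons] at hc
    by_cases h : c ≤ (A.map f).sum
    · obtain ⟨D, h1, h2, h3⟩ := ih c h
      exact ⟨D, h1.trans (Multiset.le_cons_self _ _), h2, h3⟩
    · obtain ⟨D, h1, h2, h3⟩ := ih (c - f p) (by omega)
      refine ⟨p ::ₘ D, Multiset.cons_le_cons _ h1, ?_, ?_⟩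
      · rw [Multiset.card_cons]; omega
      · rw [Multiset.map_cons, Multiset.sum_cons]; omega

/-- the parity witness -/
def ParW {m : ℕ} (b : Fin m) (S : Multiset (OffDiag m)) : Prop :=
  (∃ p S0, S = p ::ₘ S0 ∧ p.val.2 = b) ∨
    ∃ p q S0, S = p ::ₘ q ::ₘ S0 ∧ p.val.2 = q.val.2

theorem ParW.mono {m : ℕ} {b : Fin m} {S A : Multiset (OffDiag m)} (h : ParW b S)
    (hSA : S ≤ A) : ParW b A := by
  obtain ⟨R, rfl⟩ := Multiset.le_iff_exists_add.1 hSA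
  rcases h with ⟨p, S0, rfl, h⟩ | ⟨p, q, S0, rfl, h⟩
  · exact Or.inl ⟨p, S0 + R, by simp, h⟩
  · exact Or.inr ⟨p, q, S0 + R, by simp, h⟩

theorem wt_head {m : ℕ} (A : Multiset (OffDiag m)) (c : Fin m) :
    wt A c % 2 = (A.map (fun p => if p.val.2 = c then 1 else 0)).sum % 2 := by
  induction A using Multiset.induction_on with
  | empty => simp [wt]
  | cons p A ih =>
    rw [wt_cons, Multiset.map_cons, Multiset.sum_cons, edgeWt]
    split_ifs <;> omega

theorem head_of_sum {m : ℕ} (A : Multiset (OffDiag m)) (c : Fin m)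
    (h : 1 ≤ (A.map (fun p => if p.val.2 = c then 1 else 0)).sum) :
    ∃ p S0, A = p ::ₘ S0 ∧ p.val.2 = c := by
  by_contra hc
  push Not at hc
  have : (A.map (fun p => if p.val.2 = c then 1 else 0)).sum = 0 := by
    refine Multiset.sum_eq_zero fun x hx => ?_
    obtain ⟨p, hp, rfl⟩ := Multiset.mem_map.1 hx
    obtain ⟨S0, hS⟩ := Multiset.exists_cons_of_mem hp
    rw [if_neg (hc p S0 hS)]
  omega

theorem parW_of_choice {m : ℕ} {A : Multiset (OffDiag m)} {a b : Fin m}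
    (hc : Choice (wt A) a b) (hA : 2 ≤ Multiset.card A) : ParW b A := by
  rcases hc.par with h | h
  · rw [wt_head] at h
    exact Or.inl (head_of_sum A b (by omega))
  · have key : ∀ p R, A = p ::ₘ R → p.val.2 ≠ a → ParW b A := by
      intro p R hR hp
      have h1 := h _ hp
      rw [wt_head, hR, Multiset.map_cons, Multiset.sum_cons, if_pos rfl] at h1
      obtain ⟨q, S0, h2, h3⟩ := head_of_sum R p.val.2 (by omega)
      exact Or.inr ⟨p, q, S0, by rw [hR, h2], h3.symm⟩
    obtain ⟨p, hp⟩ := Multiset.card_pos_iff_exists_mem.1 (show 0 < Multiset.card A by omega)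
    obtain ⟨R, hR⟩ := Multiset.exists_cons_of_mem hp
    have hRc : 0 < Multiset.card R := by rw [hR, Multiset.card_cons] at hA; omega
    obtain ⟨q, hq⟩ := Multiset.card_pos_iff_exists_mem.1 hRc
    obtain ⟨Q, hQ⟩ := Multiset.exists_cons_of_mem hq
    by_cases h1 : p.val.2 = a
    · by_cases h2 : q.val.2 = a
      · exact Or.inr ⟨p, q, Q, by rw [hR, hQ], by rw [h1, h2]⟩
      · exact key q (p ::ₘ Q) (by rw [hR, hQ, Multiset.cons_swap]) h2
    · exact key p R hR h1

theorem parW_small {m : ℕ} {A : Multiset (OffDiag m)} {b : Fin m} (h : ParW b A) :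
    ∃ S ≤ A, Multiset.card S ≤ 2 ∧ ParW b S := by
  rcases h with ⟨p, S0, rfl, h⟩ | ⟨p, q, S0, rfl, h⟩
  · exact ⟨{p}, by simp, by simp, Or.inl ⟨p, 0, by simp, h⟩⟩
  · refine ⟨p ::ₘ q ::ₘ 0, Multiset.cons_le_cons _ (Multiset.cons_le_cons _ (zero_le)),
      by simp, Or.inr ⟨p, q, 0, rfl, h⟩⟩

theorem parW_odd {m : ℕ} {S : Multiset (OffDiag m)} {a b : Fin m} (hab : a ≠ b)
    (h : ParW b S) (hle : ∀ v, edgeWt v (mkE hab) ≤ wt S v) {k : ℕ}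
    (hk : Multiset.card S = k + 1) :
    oddN (fun v => wt S v - edgeWt v (mkE hab)) ≤ k := by
  have hval := edgeWt_mkE hab
  rcases h with ⟨p, S0, rfl, h⟩ | ⟨p, q, S0, rfl, h⟩
  · rw [oddN_congr (w' := wt S0)]
    · have := oddN_wt S0
      rw [Multiset.card_cons] at hk
      omega
    · intro v
      have h1 := hle v
      rw [wt_cons] at *
      unfold edgeWt mkE at *
      simp only at *
      rw [h] at *
      omega
  · refine le_trans (oddN_flip (w' := wt S0) b ?_) ?_
    · intro v hv
      have h1 := hle v
      rw [wt_cons, wt_cons] at *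
      unfold edgeWt mkE at *
      simp only at *
      rw [h, if_neg hv.symm] at *
      omega
    · have := oddN_wt S0
      simp only [Multiset.card_cons] at hk
      omega

theorem local_move {m : ℕ} {A : Multiset (OffDiag m)} {a b : Fin m}
    (hc : Choice (wt A) a b) (hA : 3 ≤ Multiset.card A) :
    ∃ S ≤ A, ∃ T, Multiset.card S ≤ 10 ∧ wt S = wt (mkE hc.ne ::ₘ T) := by
  classical
  obtain ⟨S1, h1, h1c, h1w⟩ := exists_sub (edgeWt a) A 2 hc.two
  obtain ⟨S2, h2, h2c, h2w⟩ := exists_sub (edgeWt b) A 1 hc.one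
  obtain ⟨S3, h3, h3c, h3w⟩ := parW_small (parW_of_choice hc (by omega))
  obtain ⟨S4, h4, h4c, h4w⟩ := exists_sub (fun _ => 1) A 3 (by simpa using hA)
  have h4w : 3 ≤ Multiset.card S4 := by simpa using h4w
  have hab := hc.ne
  have hval := edgeWt_mkE hab
  -- union
  obtain ⟨U, hU, hUc, hU1, hU2, hU3, hU4⟩ : ∃ U ≤ A, Multiset.card U ≤ 8 ∧ S1 ≤ U ∧ S2 ≤ U ∧
      S3 ≤ U ∧ S4 ≤ U := by
    refine ⟨(S1 ∪ S2) ∪ (S3 ∪ S4), Multiset.union_le (Multiset.union_le h1 h2)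
      (Multiset.union_le h3 h4), ?_, ?_, ?_, ?_, ?_⟩
    · have e1 := Multiset.card_le_card (Multiset.union_le_add (S1 ∪ S2) (S3 ∪ S4))
      have e2 := Multiset.card_le_card (Multiset.union_le_add S1 S2)
      have e3 := Multiset.card_le_card (Multiset.union_le_add S3 S4)
      simp only [Multiset.card_add] at *
      omega
    · exact Multiset.le_union_left.trans Multiset.le_union_left
    · exact Multiset.le_union_right.trans Multiset.le_union_left
    · exact Multiset.le_union_left.trans Multiset.le_union_right
    · exact Multiset.le_union_right.trans Multiset.le_union_right
  have hU4c := Multiset.card_le_card hU4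
  -- fix the vertices of large weight
  obtain ⟨S, hS, hSc, hUS, hSd⟩ : ∃ S ≤ A, Multiset.card S ≤ 10 ∧ U ≤ S ∧
      ∀ v, v ≠ a → wt S v + 2 ≤ 2 * Multiset.card S := by
    by_cases hgood : ∀ v, v ≠ a → wt U v + 2 ≤ 2 * Multiset.card U
    · exact ⟨U, hU, by omega, le_rfl, hgood⟩
    · push Not at hgood
      obtain ⟨v, hva, hv⟩ := hgood
      have hAv : 2 ≤ (A.map (fun p => 2 - edgeWt v p)).sum := by
        have e1 := wt_def A v
        have e2 := two_le_sum (wt A) hva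
        have e3 := wt_sum A
        have e4 := hc.max v
        omega
      obtain ⟨D, hD, hDc, hDw⟩ := exists_sub _ A 2 hAv
      refine ⟨U ∪ D, Multiset.union_le hU hD, ?_, Multiset.le_union_left, ?_⟩
      · have e1 := Multiset.card_le_card (Multiset.union_le_add U D)
        rw [Multiset.card_add] at e1
        omega
      · intro u hu
        have e1 := wt_def (U ∪ D) u
        by_cases huv : u = v
        · subst huv
          have := sum_mono_le (fun p => 2 - edgeWt u p) (Multiset.le_union_right (s := U) (t := D))
          omega
        · have := sum_mono_le (fun p => 2 - edgeWt u p) (Multiset.le_union_left (s := U) (t := D))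
          have e2 := two_le_sum (wt U) huv
          have e3 := wt_sum U
          have e4 := wt_def U u
          omega
  have hUSc := Multiset.card_le_card hUS
  have ha : 2 ≤ wt S a := h1w.trans (wt_mono (hU1.trans hUS) a)
  have hb : 1 ≤ wt S b := h2w.trans (wt_mono (hU2.trans hUS) b)
  have hpar : ParW b S := h3w.mono (hU3.trans hUS)
  obtain ⟨k, hk⟩ : ∃ k, Multiset.card S = k + 1 := ⟨Multiset.card S - 1, by omega⟩
  have hle : ∀ v, edgeWt v (mkE hab) ≤ wt S v := by
    intro v
    rw [hval]
    split_ifs with e1 e2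
    · subst e1; exact ha
    · subst e2; exact hb
    · omega
  obtain ⟨T, hT⟩ := exists_real k (fun v => wt S v - edgeWt v (mkE hab))
    ⟨sum_sub (by rw [wt_sum, hk]) hle, by
      intro v
      by_cases hva : v = a
      · subst hva
        have := (feas_wt S).le v
        rw [hval, if_pos rfl]
        omega
      · have := hSd v hva
        omega, parW_odd hab hpar hle hk⟩
  refine ⟨S, hS, T, hSc, funext fun v => ?_⟩
  rw [wt_cons, hT]
  have := hle v
  simp only
  omega

/-- the monomial of a multigraph -/
def mono (K : Type*) [Field K] {m : ℕ} (A : Multiset (OffDiag m)) : MvPolynomial (OffDiag m) K :=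
  (A.map X).prod

theorem mono_add (K : Type*) [Field K] {m : ℕ} (A B : Multiset (OffDiag m)) :
    mono K (A + B) = mono K A * mono K B := by simp [mono]

theorem mono_cons (K : Type*) [Field K] {m : ℕ} (p : OffDiag m) (B : Multiset (OffDiag m)) :
    mono K (p ::ₘ B) = X p * mono K B := by simp [mono]

theorem card_eq_of_wt {m : ℕ} {A B : Multiset (OffDiag m)} (h : wt A = wt B) :
    Multiset.card A = Multiset.card B := by
  have h1 := wt_sum A
  have h2 := wt_sum B
  rw [h] at h1
  omega

theorem connect (K : Type*) [Field K] {m : ℕ} (J : Ideal (MvPolynomial (OffDiag m) K))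
    (hJ : ∀ A B : Multiset (OffDiag m), Multiset.card A ≤ 10 → wt A = wt B →
      mono K A - mono K B ∈ J) (n : ℕ) :
    ∀ A B : Multiset (OffDiag m), Multiset.card A = n → wt A = wt B →
      mono K A - mono K B ∈ J := by
  induction n with
  | zero => intro A B hA hw; exact hJ A B (by omega) hw
  | succ n ih =>
    intro A B hA hw
    by_cases hs : Multiset.card A ≤ 10
    · exact hJ A B hs hw
    obtain ⟨a, b, hc⟩ := exists_choice (by omega) (feas_wt A)
    have hB := card_eq_of_wt hw
    have red : ∀ C : Multiset (OffDiag m), Multiset.card C = n + 1 → wt C = wt A →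
        ∃ C', wt (mkE hc.ne ::ₘ C') = wt A ∧ mono K C - mono K (mkE hc.ne ::ₘ C') ∈ J := by
      intro C hC hCw
      have hc' : Choice (wt C) a b := hCw ▸ hc
      obtain ⟨S, hS, T, hSc, hST⟩ := local_move hc' (by omega)
      obtain ⟨R, rfl⟩ := Multiset.le_iff_exists_add.1 hS
      refine ⟨T + R, ?_, ?_⟩
      · refine Eq.trans ?_ hCw
        rw [← Multiset.cons_add]
        funext v
        rw [wt_add, wt_add, hST]
      · rw [← Multiset.cons_add, mono_add, mono_add, ← sub_mul]
        exact J.mul_mem_right _ (hJ _ _ hSc hST)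
    obtain ⟨A', hA1, hA2⟩ := red A hA rfl
    obtain ⟨B', hB1, hB2⟩ := red B (by omega) hw.symm
    have hcard := card_eq_of_wt hA1
    rw [Multiset.card_cons] at hcard
    have h3 := ih A' B' (by omega) (by
      funext v
      have := congrFun (hA1.trans hB1.symm) v
      rw [wt_cons, wt_cons] at this
      omega)
    have h4 := J.mul_mem_left (X (mkE hc.ne)) h3
    rw [mul_sub, ← mono_cons, ← mono_cons] at h4
    have := J.sub_mem (J.add_mem hA2 h4) hB2
    convert this using 1
    ring

/-- the toric map -/
def phi (K : Type*) [Field K] (n : ℕ) : MvPolynomial (OffDiag n) K →ₐ[K] MvPolynomial (Fin n) K :=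
  aeval (fun p : OffDiag n => X p.val.1 ^ 2 * X p.val.2 : OffDiag n → MvPolynomial (Fin n) K)

theorem mem_toric (K : Type*) [Field K] (n : ℕ) (f : MvPolynomial (OffDiag n) K) :
    f ∈ toricIdeal K n ↔ phi K n f = 0 := Iff.rfl

theorem phi_X (K : Type*) [Field K] {n : ℕ} (p : OffDiag n) :
    phi K n (X p) = X p.val.1 ^ 2 * X p.val.2 := aeval_X _ _

def wtF {m : ℕ} (A : Multiset (OffDiag m)) : Fin m →₀ ℕ := Finsupp.equivFunOnFinite.symm (wt A)

theorem phi_mono (K : Type*) [Field K] {m : ℕ} (A : Multiset (OffDiag m)) :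
    phi K m (mono K A) = monomial (wtF A) 1 := by
  induction A using Multiset.induction_on with
  | empty =>
    have : wtF (0 : Multiset (OffDiag m)) = 0 := by ext v; simp [wtF, wt]
    rw [this]
    simp [mono]
  | cons p A ih =>
    have : wtF (p ::ₘ A) = (Finsupp.single p.val.1 2 + Finsupp.single p.val.2 1) + wtF A := by
      ext v
      simp only [wtF, Finsupp.equivFunOnFinite_symm_apply_apply, wt_cons, Finsupp.add_apply,
        Finsupp.single_apply, edgeWt]
      split_ifs <;> omega
    rw [mono_cons, map_mul, ih, this]
    rw [phi_X, X_pow_eq_monomial, X, monomial_mul, monomial_mul, one_mul, one_mul]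

theorem monomial_eq_mono (K : Type*) [Field K] {m : ℕ} (s : OffDiag m →₀ ℕ) :
    (monomial s 1 : MvPolynomial (OffDiag m) K) = mono K (Finsupp.toMultiset s) := by
  rw [monomial_eq, mono, Finsupp.toMultiset_map, Finsupp.prod_toMultiset]
  simp [Finsupp.prod_mapDomain_index, pow_add]

open Classical in
theorem toric_le (K : Type*) [Field K] {m : ℕ} (J : Ideal (MvPolynomial (OffDiag m) K))
    (hJ : ∀ A B : Multiset (OffDiag m), wt A = wt B → mono K A - mono K B ∈ J) :
    toricIdeal K m ≤ J := by
  let s : MvPolynomial (Fin m) K →ₗ[K] (MvPolynomial (OffDiag m) K ⧸ J) :=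
    (basisMonomials (Fin m) K).constr K (fun u =>
      if h : ∃ A : Multiset (OffDiag m), wtF A = u then Ideal.Quotient.mk J (mono K h.choose) else 0)
  have hs : s ∘ₗ (phi K m).toLinearMap = (Ideal.Quotient.mkₐ K J).toLinearMap := by
    refine (basisMonomials (OffDiag m) K).ext fun u => ?_
    simp only [coe_basisMonomials, LinearMap.comp_apply, AlgHom.toLinearMap_apply]
    rw [monomial_eq_mono, phi_mono]
    have hb := (basisMonomials (Fin m) K).constr_basis K (fun u =>
      if h : ∃ A : Multiset (OffDiag m), wtF A = u then Ideal.Quotient.mk J (mono K h.choose)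
      else 0) (wtF (Finsupp.toMultiset u))
    rw [coe_basisMonomials] at hb
    refine hb.trans ?_
    have hex : ∃ A : Multiset (OffDiag m), wtF A = wtF (Finsupp.toMultiset u) := ⟨_, rfl⟩
    rw [dif_pos hex]
    refine Ideal.Quotient.eq.2 (hJ _ _ ?_)
    exact Finsupp.equivFunOnFinite.symm.injective hex.choose_spec
  intro f hf
  rw [mem_toric] at hf
  have := LinearMap.congr_fun hs f
  rw [LinearMap.comp_apply, AlgHom.toLinearMap_apply, hf, map_zero] at this
  exact Ideal.Quotient.eq_zero_iff_mem.1 this.symm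

theorem mono_sub_mem (K : Type*) [Field K] {m : ℕ} {A B : Multiset (OffDiag m)}
    (h : wt A = wt B) : mono K A - mono K B ∈ toricIdeal K m := by
  rw [mem_toric, map_sub, phi_mono, phi_mono, wtF, wtF, h, sub_self]

theorem rename_mem (K : Type*) [Field K] {n m : ℕ} (π : Fin n → Fin m)
    (hπ : Function.Injective π) (f : MvPolynomial (OffDiag n) K) (hf : f ∈ toricIdeal K n) :
    rename (offDiagMap π hπ) f ∈ toricIdeal K m := by
  rw [mem_toric] at *
  have : (phi K m).comp (rename (offDiagMap π hπ)) = (rename π).comp (phi K n) := by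
    refine algHom_ext fun p => ?_
    rw [AlgHom.comp_apply, AlgHom.comp_apply, rename_X, phi_X, phi_X]
    simp [offDiagMap]
  have := DFunLike.congr_fun this f
  simp only [AlgHom.comp_apply, hf, map_zero] at this
  exact this

theorem rename_mono (K : Type*) [Field K] {n m : ℕ} (g : OffDiag n → OffDiag m)
    (A : Multiset (OffDiag n)) : rename g (mono K A) = mono K (A.map g) := by
  induction A using Multiset.induction_on with
  | empty => simp [mono]
  | cons p A ih => rw [mono_cons, map_mul, ih, Multiset.map_cons, mono_cons, rename_X]

theorem wt_map {n m : ℕ} (π : Fin n → Fin m) (hπ : Function.Injective π)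
    (A : Multiset (OffDiag n)) (v : Fin n) : wt (A.map (offDiagMap π hπ)) (π v) = wt A v := by
  induction A using Multiset.induction_on with
  | empty => simp [wt]
  | cons p A ih =>
    rw [Multiset.map_cons, wt_cons, wt_cons, ih]
    simp [edgeWt, offDiagMap, hπ.eq_iff]

theorem wt_pos_of_mem {m : ℕ} {A : Multiset (OffDiag m)} {p : OffDiag m} (h : p ∈ A) :
    wt A p.val.1 ≠ 0 ∧ wt A p.val.2 ≠ 0 := by
  obtain ⟨R, rfl⟩ := Multiset.exists_cons_of_mem h
  rw [wt_cons, wt_cons]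
  simp [edgeWt]

theorem supp_card {m : ℕ} (A : Multiset (OffDiag m)) :
    (Finset.univ.filter (fun v => wt A v ≠ 0)).card ≤ 2 * Multiset.card A := by
  induction A using Multiset.induction_on with
  | empty => simp [wt]
  | cons p A ih =>
    have : (Finset.univ.filter (fun v => wt (p ::ₘ A) v ≠ 0)) ⊆
        insert p.val.1 (insert p.val.2 (Finset.univ.filter (fun v => wt A v ≠ 0))) := by
      intro v hv
      by_cases h1 : v = p.val.1
      · simp [h1]
      · by_cases h2 : v = p.val.2
        · simp [h2]
        · simp [wt_cons, edgeWt, Ne.symm h1, Ne.symm h2] at hv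
          simp [hv]
    have h1 := Finset.card_le_card this
    have h2 := Finset.card_insert_le p.val.1
      (insert p.val.2 (Finset.univ.filter (fun v => wt A v ≠ 0)))
    have h3 := Finset.card_insert_le p.val.2 (Finset.univ.filter (fun v => wt A v ≠ 0))
    rw [Multiset.card_cons]
    omega

theorem exists_lift {α β : Type*} (g : α → β) (A : Multiset β) (h : ∀ p ∈ A, ∃ q, g q = p) :
    ∃ A0 : Multiset α, A0.map g = A := by
  induction A using Multiset.induction_on with
  | empty => exact ⟨0, rfl⟩
  | cons p A ih =>
    obtain ⟨A0, hA⟩ := ih fun q hq => h q (Multiset.mem_cons_of_mem hq)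
    obtain ⟨q, hq⟩ := h p (Multiset.mem_cons_self _ _)
    exact ⟨q ::ₘ A0, by rw [Multiset.map_cons, hA, hq]⟩

theorem exists_lift_pair {m : ℕ} (hm : 20 ≤ m) (A B : Multiset (OffDiag m))
    (hA : Multiset.card A ≤ 10) (hw : wt A = wt B) :
    ∃ (π : Fin 20 → Fin m) (hπ : Function.Injective π) (A0 B0 : Multiset (OffDiag 20)),
      A0.map (offDiagMap π hπ) = A ∧ B0.map (offDiagMap π hπ) = B ∧ wt A0 = wt B0 := by
  have hc := supp_card A
  obtain ⟨W, hW, hWc⟩ := Finset.exists_superset_card_eq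
    (s := Finset.univ.filter (fun v => wt A v ≠ 0)) (n := 20) (by omega) (by simpa using hm)
  let π := W.orderEmbOfFin hWc
  have hr : ∀ v, wt A v ≠ 0 → ∃ i, π i = v := by
    intro v hv
    have : v ∈ Set.range π := by
      rw [Finset.range_orderEmbOfFin]
      exact hW (by simp [hv])
    exact this
  have hlift : ∀ C : Multiset (OffDiag m), wt C = wt A → ∃ C0 : Multiset (OffDiag 20),
      C0.map (offDiagMap π π.injective) = C := by
    intro C hC
    refine exists_lift _ C fun p hp => ?_
    obtain ⟨h1, h2⟩ := wt_pos_of_mem hp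
    rw [hC] at h1 h2
    obtain ⟨i, hi⟩ := hr _ h1
    obtain ⟨j, hj⟩ := hr _ h2
    refine ⟨⟨(i, j), fun h => p.prop ?_⟩, ?_⟩
    · rw [← hi, ← hj]; exact congrArg π h
    · apply Subtype.ext
      exact Prod.ext hi hj
  obtain ⟨A0, hA0⟩ := hlift A rfl
  obtain ⟨B0, hB0⟩ := hlift B hw.symm
  refine ⟨π, π.injective, A0, B0, hA0, hB0, funext fun v => ?_⟩
  rw [← wt_map π π.injective A0, ← wt_map π π.injective B0, hA0, hB0, hw]

theorem finite_card_le {α : Type*} [Finite α] (d : ℕ) :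
    {A : Multiset α | Multiset.card A ≤ d}.Finite := by
  classical
  have := Fintype.ofFinite α
  refine (Set.finite_Iic (d • (Finset.univ : Finset α).val)).subset fun A hA => ?_
  refine Multiset.le_iff_count.2 fun a => ?_
  rw [Multiset.count_nsmul, Multiset.count_eq_one_of_mem Finset.univ.nodup (Finset.mem_univ a)]
  have := Multiset.count_le_card a A
  simp at hA
  omega

instance (n : ℕ) : Finite (OffDiag n) := inferInstanceAs (Finite {p : Fin n × Fin n // p.1 ≠ p.2})

def genSet (K : Type*) [Field K] : Set (MvPolynomial (OffDiag 20) K) :=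
  {f | ∃ A B : Multiset (OffDiag 20), Multiset.card A ≤ 10 ∧ Multiset.card B ≤ 10 ∧
    wt A = wt B ∧ f = mono K A - mono K B}

theorem genSet_finite (K : Type*) [Field K] : (genSet K).Finite := by
  refine (((finite_card_le (α := OffDiag 20) 10).prod (finite_card_le 10)).image
    (fun q => mono K q.1 - mono K q.2)).subset ?_
  rintro f ⟨A, B, hA, hB, -, rfl⟩
  exact ⟨(A, B), ⟨hA, hB⟩, rfl⟩

end ToricAux

/-- The chain of toric ideals `I_n = ker(y_{ij} ↦ x_i²·x_j)` stabilizes up to the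
symmetric group: there are `N ≥ 2` and a finite `G ⊆ I_N` such that for all
`m ≥ N`, the ideal `I_m` is generated by the images of `G` under all substitutions
`y_{ij} ↦ y_{π(i)π(j)}` for injective `π : {1,…,N} → {1,…,m}`. -/
theorem toric_chain_stabilizes (K : Type*) [Field K] :
    ∃ (N : ℕ), 2 ≤ N ∧ ∃ G : Finset (MvPolynomial (OffDiag N) K),
      (↑G : Set (MvPolynomial (OffDiag N) K)) ⊆ toricIdeal K N ∧
      ∀ m, N ≤ m → toricIdeal K m =
        Ideal.span {f : MvPolynomial (OffDiag m) K |
          ∃ (π : Fin N → Fin m) (hπ : Function.Injective π) (g : MvPolynomial (OffDiag N) K),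
            g ∈ G ∧ f = rename (offDiagMap π hπ) g} := by
  refine ⟨20, by norm_num, (genSet_finite K).toFinset, ?_, ?_⟩
  · rw [Set.Finite.coe_toFinset]
    rintro f ⟨A, B, -, -, h, rfl⟩
    exact mono_sub_mem K h
  · intro m hm
    apply le_antisymm
    · refine toric_le K _ fun A B hw => connect K _ ?_ _ A B rfl hw
      intro A B hA hw
      obtain ⟨π, hπ, A0, B0, rfl, rfl, h⟩ := exists_lift_pair hm A B hA hw
      refine Ideal.subset_span ⟨π, hπ, mono K A0 - mono K B0, ?_, ?_⟩
      · rw [Set.Finite.mem_toFinset]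
        have h2 := card_eq_of_wt h
        rw [Multiset.card_map] at hA
        exact ⟨A0, B0, hA, by omega, h, rfl⟩
      · rw [map_sub, rename_mono, rename_mono]
    · rw [Ideal.span_le]
      rintro f ⟨π, hπ, g, hg, rfl⟩
      rw [Set.Finite.mem_toFinset] at hg
      obtain ⟨A, B, -, -, h, rfl⟩ := hg
      exact rename_mem K π hπ _ (mono_sub_mem K h)
end

section
/- Let K be a field and R = K[x_i : i ∈ ℕ]. For every f ∈ R and every finitary permutation σ of ℕ, there exist a strictly increasing function ρ : ℕ → ℕ and a finitary permutation τ of ℕ fixing every index ≥ w(f) such that σ·f = ρ·(τ·f), where the actions are by renaming variables. Consequently, the S_∞-orbit of f equals the union over the finitely many permutations τ of {0, …, w(f)−1} of the Inc(ℕ)-orbits of τ·f. -/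
open MvPolynomial

/-- A finitary permutation of `ℕ`: one moving only finitely many points. -/
def Finitary (σ : Equiv.Perm ℕ) : Prop := {n | σ n ≠ n}.Finite

/-- The width of a polynomial `f ∈ K[x_0, x_1, …]`: the smallest `n` such that every
finitary permutation fixing `{0, …, n−1}` pointwise fixes `f`. -/
noncomputable def width {K : Type*} [CommSemiring K] (f : MvPolynomial ℕ K) : ℕ :=
  sInf {n | ∀ σ : Equiv.Perm ℕ, Finitary σ → (∀ i < n, σ i = i) → rename (⇑σ) f = f}

theorem rename_congr_on {K : Type*} [CommSemiring K] (f : MvPolynomial ℕ K) (g h : ℕ → ℕ)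
    (H : ∀ i ∈ f.vars, g i = h i) : rename g f = rename h f := by
  have := hom_congr_vars (f₁ := (rename g : MvPolynomial ℕ K →ₐ[K] _).toRingHom)
    (f₂ := (rename h : MvPolynomial ℕ K →ₐ[K] _).toRingHom) (p₁ := f) (p₂ := f)
    (by ext1 a; simp) (by intro i hi _; simp [H i hi]) rfl
  simpa using this

theorem finitary_swap (a b : ℕ) : Finitary (Equiv.swap a b) := by
  refine (Set.toFinite ({a, b} : Set ℕ)).subset ?_
  intro n hn
  by_contra hc
  simp only [Set.mem_insert_iff, Set.mem_singleton_iff, not_or] at hc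
  exact hn (Equiv.swap_apply_of_ne_of_ne hc.1 hc.2)

theorem finitary_mul {a b : Equiv.Perm ℕ} (ha : Finitary a) (hb : Finitary b) :
    Finitary (a * b) := by
  refine (Set.Finite.union ha hb).subset ?_
  intro n hn
  by_contra hc
  simp only [Set.mem_union, Set.mem_ofPred_eq, not_or, not_not] at hc
  exact hn (by simp [Equiv.Perm.mul_apply, hc.1, hc.2])

theorem vars_lt_width {K : Type*} [CommSemiring K] (f : MvPolynomial ℕ K) (v : ℕ)
    (hv : v ∈ f.vars) : v < width f := by
  have hne : {n | ∀ σ : Equiv.Perm ℕ, Finitary σ → (∀ i < n, σ i = i) →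
      rename (⇑σ) f = f}.Nonempty := by
    refine ⟨f.vars.sup id + 1, fun σ _ h => ?_⟩
    rw [rename_congr_on f σ id fun i hi => h i (Nat.lt_succ_of_le (Finset.le_sup (f := id) hi))]
    simp
  have hw := Nat.sInf_mem hne
  change ∀ σ : Equiv.Perm ℕ, Finitary σ → (∀ i < width f, σ i = i) → rename (⇑σ) f = f at hw
  by_contra hlt
  have hm : ∀ i ∈ f.vars, i < f.vars.sup id + 1 + width f := fun i hi => by
    have := Finset.le_sup (f := id) hi
    simp only [id] at this
    omega
  have hm2 : width f ≤ f.vars.sup id + 1 + width f := by omega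
  generalize f.vars.sup id + 1 + width f = m at hm hm2
  have h1 := hw (Equiv.swap v m) (finitary_swap _ _) (by
    intro i hi
    exact Equiv.swap_apply_of_ne_of_ne (by omega) (by omega))
  have h2 : (Equiv.swap v m) v ∈ f.vars := by
    classical
    rw [mem_vars_iff_mem_support] at hv
    obtain ⟨d, hd, hvd⟩ := hv
    rw [← h1, mem_vars_iff_mem_support]
    refine ⟨d.mapDomain (Equiv.swap v m), ?_, ?_⟩
    · rw [mem_support_iff, coeff_rename_mapDomain _ (Equiv.injective _)]
      exact mem_support_iff.1 hd
    · rw [Finsupp.mem_support_iff, Finsupp.mapDomain_apply (Equiv.injective _)]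
      exact Finsupp.mem_support_iff.1 hvd
  rw [Equiv.swap_apply_left] at h2
  exact absurd (hm _ h2) (lt_irrefl _)

theorem exists_finitary_agree (g : ℕ → ℕ) (hg : Function.Injective g) (w : ℕ) :
    ∃ σ : Equiv.Perm ℕ, Finitary σ ∧ ∀ i < w, σ i = g i := by
  induction w with
  | zero => exact ⟨1, by simp [Finitary], by simp⟩
  | succ w ih =>
    obtain ⟨s, hs, h⟩ := ih
    refine ⟨Equiv.swap (s w) (g w) * s, finitary_mul (finitary_swap _ _) hs, ?_⟩
    intro i hi
    rcases Nat.lt_succ_iff_lt_or_eq.1 hi with hi | rfl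
    · rw [Equiv.Perm.mul_apply, Equiv.swap_apply_of_ne_of_ne, h i hi]
      · exact fun e => hi.ne (s.injective e)
      · rw [h i hi]
        exact fun e => hi.ne (hg e)
    · simp

theorem exists_factor (s : ℕ → ℕ) (hs : Function.Injective s) (w : ℕ) :
    ∃ ρ : ℕ → ℕ, StrictMono ρ ∧ ∃ τ : Equiv.Perm ℕ, Finitary τ ∧
      (∀ i, w ≤ i → τ i = i) ∧ ∀ i < w, s i = ρ (τ i) := by
  classical
  set S := (Finset.range w).image s with hS
  have hc : S.card = w := by rw [hS, Finset.card_image_of_injective _ hs, Finset.card_range]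
  let e := S.orderIsoOfFin hc
  have hmem : ∀ i : Fin w, s i ∈ S := fun i =>
    Finset.mem_image_of_mem _ (Finset.mem_range.2 i.2)
  let t : Fin w → Fin w := fun i => e.symm ⟨s i, hmem i⟩
  have ht : Function.Injective t := by
    intro i j hij
    have := e.symm.injective hij
    exact Fin.ext (hs (congrArg Subtype.val this))
  let p : Equiv.Perm (Fin w) := Equiv.ofBijective t (Finite.injective_iff_bijective.1 ht)
  let τ : Equiv.Perm ℕ := p.extendDomain (Fin.equivSubtype (n := w))
  have hτ : ∀ i (hi : i < w), τ i = t ⟨i, hi⟩ := by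
    intro i hi
    exact Equiv.Perm.extendDomain_apply_subtype p (Fin.equivSubtype (n := w)) hi
  have hτ' : ∀ i, w ≤ i → τ i = i := fun i hi =>
    Equiv.Perm.extendDomain_apply_not_subtype p (Fin.equivSubtype (n := w)) (by omega)
  refine ⟨fun i => if h : i < w then (e ⟨i, h⟩ : ℕ) else S.sup id + 1 + i, ?_, τ, ?_, hτ', ?_⟩
  · intro i j hij
    by_cases hj : j < w
    · have hi : i < w := hij.trans hj
      simp only [hi, hj, dif_pos]
      exact e.strictMono (show (⟨i, hi⟩ : Fin w) < ⟨j, hj⟩ from hij)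
    · by_cases hi : i < w
      · simp only [hi, hj, dif_pos, dif_neg, not_false_eq_true]
        have := Finset.le_sup (f := id) (e ⟨i, hi⟩).2
        simp only [id] at this
        omega
      · simp only [hi, hj, dif_neg, not_false_eq_true]
        omega
  · refine (Set.finite_lt_nat w).subset ?_
    intro n hn
    by_contra h
    exact hn (hτ' n (not_lt.1 h))
  · intro i hi
    have h1 : τ i < w := by rw [hτ i hi]; exact (t ⟨i, hi⟩).2
    have h2 : (⟨τ i, h1⟩ : Fin w) = t ⟨i, hi⟩ := Fin.ext (hτ i hi)
    simp only [h1, dif_pos, h2]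
    simp [t]

/-- Every finitary-permutation image `σ·f` factors as `ρ·(τ·f)` with `ρ` strictly
increasing and `τ` a finitary permutation fixing all indices `≥ w(f)`; consequently
the `S_∞`-orbit of `f` is the union over such `τ` of the `Inc(ℕ)`-orbits of `τ·f`. -/
theorem orbit_decomposition {K : Type*} [Field K] (f : MvPolynomial ℕ K) :
    (∀ σ : Equiv.Perm ℕ, Finitary σ →
      ∃ (ρ : ℕ → ℕ), StrictMono ρ ∧ ∃ τ : Equiv.Perm ℕ, Finitary τ ∧
        (∀ i, width f ≤ i → τ i = i) ∧
        rename (⇑σ) f = rename ρ (rename (⇑τ) f)) ∧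
    {g | ∃ σ : Equiv.Perm ℕ, Finitary σ ∧ g = rename (⇑σ) f} =
      {g | ∃ (τ : Equiv.Perm ℕ) (ρ : ℕ → ℕ), Finitary τ ∧ (∀ i, width f ≤ i → τ i = i) ∧
        StrictMono ρ ∧ g = rename ρ (rename (⇑τ) f)} := by
  have key : ∀ σ : Equiv.Perm ℕ, Finitary σ →
      ∃ (ρ : ℕ → ℕ), StrictMono ρ ∧ ∃ τ : Equiv.Perm ℕ, Finitary τ ∧
        (∀ i, width f ≤ i → τ i = i) ∧
        rename (⇑σ) f = rename ρ (rename (⇑τ) f) := by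
    intro σ _
    obtain ⟨ρ, hρ, τ, hτ, hfix, h⟩ := exists_factor σ σ.injective (width f)
    refine ⟨ρ, hρ, τ, hτ, hfix, ?_⟩
    rw [rename_rename]
    exact rename_congr_on f _ _ fun i hi => h i (vars_lt_width f i hi)
  refine ⟨key, ?_⟩
  ext g
  constructor
  · rintro ⟨σ, hσ, rfl⟩
    obtain ⟨ρ, hρ, τ, hτ, hfix, h⟩ := key σ hσ
    exact ⟨τ, ρ, hτ, hfix, hρ, h⟩
  · rintro ⟨τ, ρ, hτ, hfix, hρ, rfl⟩
    obtain ⟨σ, hσ, h⟩ := exists_finitary_agree (ρ ∘ τ) (hρ.injective.comp τ.injective) (width f)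
    refine ⟨σ, hσ, ?_⟩
    rw [rename_rename]
    exact rename_congr_on f _ _ fun i hi => (h i (vars_lt_width f i hi)).symm
end

section
/- Let K be a field, k ≥ 1, and R = K[x_{ij} : i ∈ {1,…,k}, j ∈ ℕ]. If an ideal I ⊆ R is S_∞-invariant, i.e. σ·I ⊆ I for every finitary permutation σ of ℕ acting by x_{ij} ↦ x_{iσ(j)}, then I is Inc(ℕ)-invariant, i.e. ρ·I ⊆ I for every strictly increasing function ρ : ℕ → ℕ acting by x_{ij} ↦ x_{iρ(j)}. -/
open MvPolynomial

/-- An injective map agrees with a finitary permutation on any initial segment. -/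
theorem exists_finitary_perm_agree (ρ : ℕ → ℕ) (hρ : Function.Injective ρ) (n : ℕ) :
    ∃ σ : Equiv.Perm ℕ, {m | σ m ≠ m}.Finite ∧ ∀ j < n, σ j = ρ j := by
  induction n with
  | zero => exact ⟨1, by simp, by simp⟩
  | succ n ih =>
    obtain ⟨σ, hf, hσ⟩ := ih
    refine ⟨σ.trans (Equiv.swap (σ n) (ρ n)), ?_, ?_⟩
    · refine (hf.union (Set.toFinite {σ n, ρ n})).subset ?_
      intro m hm
      by_contra hc
      simp only [Set.mem_union, Set.mem_setOf_eq, Set.mem_insert_iff, Set.mem_singleton_iff,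
        not_or, not_not] at hc
      apply hm
      rw [Equiv.trans_apply, hc.1, Equiv.swap_apply_of_ne_of_ne hc.2.1 hc.2.2]
    · intro j hj
      rw [Equiv.trans_apply]
      rcases Nat.lt_succ_iff_lt_or_eq.mp hj with h | rfl
      · rw [Equiv.swap_apply_of_ne_of_ne, hσ j h]
        · exact fun e => h.ne (σ.injective e)
        · rw [hσ j h]
          exact fun e => h.ne (hρ e)
      · exact Equiv.swap_apply_left _ _

/-- Every `S_∞`-invariant ideal of `K[x_{ij} : i ∈ {1,…,k}, j ∈ ℕ]` (invariant under
all finitary permutations of the second index) is `Inc(ℕ)`-invariant (invariant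
under all strictly increasing maps on the second index). -/
theorem sInf_invariant_imp_inc_invariant (K : Type*) [Field K] (k : ℕ) (hk : 1 ≤ k)
    (I : Ideal (MvPolynomial (Fin k × ℕ) K))
    (hI : ∀ σ : Equiv.Perm ℕ, {n | σ n ≠ n}.Finite →
      ∀ f ∈ I, rename (fun p : Fin k × ℕ => (p.1, σ p.2)) f ∈ I) :
    ∀ ρ : ℕ → ℕ, StrictMono ρ →
      ∀ f ∈ I, rename (fun p : Fin k × ℕ => (p.1, ρ p.2)) f ∈ I := by
  intro ρ hρ f hf
  obtain ⟨σ, hfin, hσ⟩ := exists_finitary_perm_agree ρ hρ.injective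
    (f.vars.sup (fun p => p.2) + 1)
  have key : rename (fun p : Fin k × ℕ => (p.1, ρ p.2)) f
      = rename (fun p : Fin k × ℕ => (p.1, σ p.2)) f := by
    refine hom_congr_vars
      (f₁ := (rename (R := K) (fun p : Fin k × ℕ => (p.1, ρ p.2))).toRingHom)
      (f₂ := (rename (R := K) (fun p : Fin k × ℕ => (p.1, σ p.2))).toRingHom) ?_ ?_ rfl
    · ext; simp
    · intro i hi _
      have h := hσ i.2 (Nat.lt_succ_of_le (Finset.le_sup (f := fun p : Fin k × ℕ => p.2) hi))
      simp [h]
  rw [key]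
  exact hI σ hfin f hf
end

section
/- Let K be a field, k ≥ 1, and R = K[x_{ij} : i ∈ {1,…,k}, j ∈ ℕ]. Let I ⊆ R be an S_∞-invariant ideal. Then I is S_∞-finitely generated (there is a finite set F ⊆ I such that I is generated by { σ·f : σ a finitary permutation of ℕ, f ∈ F }) if and only if I is Inc(ℕ)-finitely generated (there is a finite set F ⊆ I such that I is generated by { ρ·f : ρ ∈ Inc(ℕ), f ∈ F }). -/
open MvPolynomial

lemma aux_congr {K : Type*} [Field K] {k : ℕ} (f : MvPolynomial (Fin k × ℕ) K) (N : ℕ)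
    (hN : ∀ p ∈ f.vars, p.2 < N) (a b : ℕ → ℕ) (h : ∀ i < N, a i = b i) :
    rename (fun p : Fin k × ℕ => (p.1, a p.2)) f = rename (fun p : Fin k × ℕ => (p.1, b p.2)) f := by
  have := MvPolynomial.hom_congr_vars (p₁ := f) (p₂ := f)
    (f₁ := (rename (R := K) (fun p : Fin k × ℕ => (p.1, a p.2))).toRingHom)
    (f₂ := (rename (R := K) (fun p : Fin k × ℕ => (p.1, b p.2))).toRingHom)
    (by ext x; simp) (by
      intro i hi _
      simp [h _ (hN i hi)]) rfl
  simpa using this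

lemma aux_bound {K : Type*} [Field K] {k : ℕ} (F : Finset (MvPolynomial (Fin k × ℕ) K)) :
    ∃ N : ℕ, ∀ f ∈ F, ∀ p ∈ f.vars, p.2 < N := by
  classical
  refine ⟨((F.biUnion fun f => f.vars).sup fun p => p.2) + 1, fun f hf p hp => ?_⟩
  exact Nat.lt_succ_of_le (Finset.le_sup (f := fun p : Fin k × ℕ => p.2)
    (Finset.mem_biUnion.2 ⟨f, hf, hp⟩))

lemma aux_perm (τ : ℕ → ℕ) (hτ : Function.Injective τ) (N : ℕ) :
    ∃ σ : Equiv.Perm ℕ, {n | σ n ≠ n}.Finite ∧ ∀ i < N, τ i = σ i := by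
  induction N with
  | zero => exact ⟨1, by simp, by simp⟩
  | succ N ih =>
    obtain ⟨σ, hf, h⟩ := ih
    refine ⟨Equiv.swap (σ N) (τ N) * σ, ?_, ?_⟩
    · refine (hf.union (Set.toFinite {σ N, τ N})).subset ?_
      intro n hn
      by_contra hc
      simp only [Set.mem_union, Set.mem_setOf_eq, Set.mem_insert_iff, Set.mem_singleton_iff,
        not_or, not_not] at hc
      apply hn
      rw [Equiv.Perm.mul_apply, hc.1, Equiv.swap_apply_of_ne_of_ne hc.2.1 hc.2.2]
    · intro i hi
      rcases Nat.lt_succ_iff_lt_or_eq.1 hi with hi | rfl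
      · rw [Equiv.Perm.mul_apply, Equiv.swap_apply_of_ne_of_ne, h i hi]
        · exact fun e => hi.ne (σ.injective e)
        · rw [← h i hi]; exact fun e => hi.ne (hτ e)
      · simp

lemma aux_sort (σ : ℕ → ℕ) (hσ : Function.Injective σ) (N : ℕ) :
    ∃ (π : Equiv.Perm (Fin N)) (ρ : ℕ → ℕ), StrictMono ρ ∧ ∀ i : Fin N, σ i = ρ (π i) := by
  let s : Fin N → ℕ := fun i => σ i
  have hs : StrictMono (s ∘ Tuple.sort s) :=
    (Tuple.monotone_sort s).strictMono_of_injective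
      ((hσ.comp Fin.val_injective).comp (Tuple.sort s).injective)
  have hM : ∀ i, s i ≤ Finset.univ.sup s := fun i => Finset.le_sup (Finset.mem_univ i)
  refine ⟨(Tuple.sort s)⁻¹, fun n => if h : n < N then s (Tuple.sort s ⟨n, h⟩)
    else n + 1 + Finset.univ.sup s, ?_, ?_⟩
  · intro a b hab
    dsimp only
    split_ifs with h1 h2 h2
    · exact hs (show (⟨a, h1⟩ : Fin N) < ⟨b, h2⟩ from hab)
    · have := hM (Tuple.sort s ⟨a, h1⟩); omega
    · omega
    · omega
  · intro i
    simp [s]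

/-- An `S_∞`-invariant ideal of `K[x_{ij} : i ∈ {1,…,k}, j ∈ ℕ]` is `S_∞`-finitely
generated if and only if it is `Inc(ℕ)`-finitely generated. -/
theorem sInf_fg_iff_inc_fg (K : Type*) [Field K] (k : ℕ) (hk : 1 ≤ k)
    (I : Ideal (MvPolynomial (Fin k × ℕ) K))
    (hI : ∀ σ : Equiv.Perm ℕ, {n | σ n ≠ n}.Finite →
      ∀ f ∈ I, rename (fun p : Fin k × ℕ => (p.1, σ p.2)) f ∈ I) :
    (∃ F : Finset (MvPolynomial (Fin k × ℕ) K), (↑F : Set (MvPolynomial (Fin k × ℕ) K)) ⊆ I ∧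
      I = Ideal.span {g | ∃ (σ : Equiv.Perm ℕ) (f : MvPolynomial (Fin k × ℕ) K),
        {n | σ n ≠ n}.Finite ∧ f ∈ F ∧ g = rename (fun p : Fin k × ℕ => (p.1, σ p.2)) f}) ↔
    (∃ F : Finset (MvPolynomial (Fin k × ℕ) K), (↑F : Set (MvPolynomial (Fin k × ℕ) K)) ⊆ I ∧
      I = Ideal.span {g | ∃ (ρ : ℕ → ℕ) (f : MvPolynomial (Fin k × ℕ) K),
        StrictMono ρ ∧ f ∈ F ∧ g = rename (fun p : Fin k × ℕ => (p.1, ρ p.2)) f}) := by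
  classical
  have key : ∀ τ : ℕ → ℕ, Function.Injective τ → ∀ f : MvPolynomial (Fin k × ℕ) K,
      ∃ σ : Equiv.Perm ℕ, {n | σ n ≠ n}.Finite ∧
        rename (fun p : Fin k × ℕ => (p.1, τ p.2)) f =
          rename (fun p : Fin k × ℕ => (p.1, σ p.2)) f := by
    intro τ hτ f
    obtain ⟨N, hN⟩ := aux_bound {f}
    obtain ⟨σ, hσ, h⟩ := aux_perm τ hτ N
    exact ⟨σ, hσ, aux_congr f N (hN f (by simp)) τ σ h⟩
  constructor
  · rintro ⟨F, hF, hspan⟩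
    obtain ⟨N, hN⟩ := aux_bound F
    let ext : Equiv.Perm (Fin N) → Equiv.Perm ℕ := fun π => π.viaEmbedding Fin.valEmbedding
    have hext : ∀ π, ∀ i : Fin N, ext π i = π i := fun π i =>
      Equiv.Perm.viaEmbedding_apply π Fin.valEmbedding i
    have hfin : ∀ π, {n | ext π n ≠ n}.Finite := by
      intro π
      refine (Set.finite_range (Fin.valEmbedding : Fin N ↪ ℕ)).subset fun n hn => ?_
      by_contra hc
      exact hn (Equiv.Perm.viaEmbedding_apply_of_notMem π _ n hc)
    let F' : Finset (MvPolynomial (Fin k × ℕ) K) :=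
      (Finset.univ ×ˢ F).image fun q : Equiv.Perm (Fin N) × MvPolynomial (Fin k × ℕ) K =>
        rename (fun p : Fin k × ℕ => (p.1, ext q.1 p.2)) q.2
    have hF' : ∀ g ∈ F', g ∈ I := by
      intro g hg
      obtain ⟨⟨π, f⟩, hq, rfl⟩ := Finset.mem_image.1 hg
      exact hI _ (hfin π) f (hF (Finset.mem_product.1 hq).2)
    refine ⟨F', hF', le_antisymm ?_ ?_⟩
    · conv_lhs => rw [hspan]
      refine Ideal.span_le.2 ?_
      rintro g ⟨σ, f, -, hf, rfl⟩
      obtain ⟨π, ρ, hρ, h⟩ := aux_sort σ σ.injective N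
      refine Ideal.subset_span ⟨ρ, rename (fun p : Fin k × ℕ => (p.1, ext π p.2)) f, hρ,
        Finset.mem_image.2 ⟨(π, f), by simp [hf], rfl⟩, ?_⟩
      rw [rename_rename]
      refine aux_congr f N (hN f hf) σ (fun i => ρ (ext π i)) fun i hi => ?_
      have h1 := h ⟨i, hi⟩
      have h2 := hext π ⟨i, hi⟩
      simp only at h1 h2
      rw [h1, h2]
    · refine Ideal.span_le.2 ?_
      rintro g ⟨ρ, f, hρ, hf, rfl⟩
      obtain ⟨σ, hσ, h⟩ := key ρ hρ.injective f
      rw [h]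
      exact hI σ hσ f (hF' f hf)
  · rintro ⟨F, hF, hspan⟩
    refine ⟨F, hF, le_antisymm ?_ ?_⟩
    · conv_lhs => rw [hspan]
      refine Ideal.span_le.2 ?_
      rintro g ⟨ρ, f, hρ, hf, rfl⟩
      obtain ⟨σ, hσ, h⟩ := key ρ hρ.injective f
      exact Ideal.subset_span ⟨σ, f, hσ, hf, h⟩
    · refine Ideal.span_le.2 ?_
      rintro g ⟨σ, f, hσ, hf, rfl⟩
      exact hI σ hσ f (hF hf)
end

section
/- (Hillar–Sullivant) Let K be a field and k ≥ 1. The polynomial ring K[x_{ij} : i ∈ {1,…,k}, j ∈ ℕ] is Inc(ℕ)-Noetherian: for every ideal I that is Inc(ℕ)-invariant (ρ·I ⊆ I for all strictly increasing ρ : ℕ → ℕ acting by x_{ij} ↦ x_{iρ(j)}), there exists a finite subset F ⊆ I such that I is generated as an ideal by { ρ·f : ρ ∈ Inc(ℕ), f ∈ F }. -/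
open MvPolynomial

namespace IncNoeth

/-- The action of `ρ` on the variable indices. -/
def act (k : ℕ) (ρ : ℕ → ℕ) : Fin k × ℕ → Fin k × ℕ := fun p => (p.1, ρ p.2)

lemma act_injective (k : ℕ) {ρ : ℕ → ℕ} (h : StrictMono ρ) : Function.Injective (act k ρ) := by
  rintro ⟨i, j⟩ ⟨i', j'⟩ e
  simp only [act, Prod.mk.injEq] at e
  exact Prod.ext e.1 (h.injective e.2)

/-- reindexing by the reversed lexicographic order. -/
def reidx (k : ℕ) : Fin k × ℕ ≃ (ℕ ×ₗ Fin k)ᵒᵈ :=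
  (Equiv.prodComm _ _).trans (toLex.trans OrderDual.toDual)

/-- The lexicographic monomial order in which `x_{ij}` with large `j` dominate. -/
noncomputable def incOrder (k : ℕ) : MonomialOrder (Fin k × ℕ) where
  syn := (MonomialOrder.lex (σ := (ℕ ×ₗ Fin k)ᵒᵈ)).syn
  toSyn := (Finsupp.domCongr (reidx k)).trans (MonomialOrder.lex (σ := (ℕ ×ₗ Fin k)ᵒᵈ)).toSyn
  toSyn_monotone := by
    intro a b h
    apply (MonomialOrder.lex (σ := (ℕ ×ₗ Fin k)ᵒᵈ)).toSyn_monotone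
    intro x
    exact h ((reidx k).symm x)

lemma incOrder_lt_iff {k : ℕ} {a b : Fin k × ℕ →₀ ℕ} :
    (incOrder k).toSyn a < (incOrder k).toSyn b ↔
      ∃ q : Fin k × ℕ, (∀ p : Fin k × ℕ, (q.2 < p.2 ∨ q.2 = p.2 ∧ q.1 < p.1) → a p = b p) ∧
        a q < b q := by
  have h0 : (incOrder k).toSyn a < (incOrder k).toSyn b ↔
      ∃ i : (ℕ ×ₗ Fin k)ᵒᵈ, (∀ j, j < i → a ((reidx k).symm j) = b ((reidx k).symm j)) ∧
        a ((reidx k).symm i) < b ((reidx k).symm i) := Iff.rfl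
  rw [h0, ← (reidx k).exists_congr_right]
  refine exists_congr fun q => ?_
  rw [← (reidx k).forall_congr_right]
  simp only [Equiv.symm_apply_apply]
  have h1 : ∀ p, reidx k p < reidx k q ↔ (q.2 < p.2 ∨ q.2 = p.2 ∧ q.1 < p.1) := by
    intro p
    change toLex (q.2, q.1) < toLex (p.2, p.1) ↔ _
    rw [Prod.Lex.toLex_lt_toLex]
  simp only [h1]

lemma incOrder_mapDomain {k : ℕ} {ρ : ℕ → ℕ} (hρ : StrictMono ρ) {a b : Fin k × ℕ →₀ ℕ}
    (h : (incOrder k).toSyn a < (incOrder k).toSyn b) :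
    (incOrder k).toSyn (a.mapDomain (act k ρ)) < (incOrder k).toSyn (b.mapDomain (act k ρ)) := by
  rw [incOrder_lt_iff] at h ⊢
  obtain ⟨q, h1, h2⟩ := h
  refine ⟨act k ρ q, fun p hp => ?_, ?_⟩
  · by_cases hr : p ∈ Set.range (act k ρ)
    · obtain ⟨p, rfl⟩ := hr
      rw [Finsupp.mapDomain_apply (act_injective k hρ), Finsupp.mapDomain_apply (act_injective k hρ)]
      apply h1
      simpa [act, hρ.lt_iff_lt, hρ.injective.eq_iff] using hp
    · rw [Finsupp.mapDomain_of_notMem_range _ _ hr, Finsupp.mapDomain_of_notMem_range _ _ hr]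
  · rwa [Finsupp.mapDomain_apply (act_injective k hρ), Finsupp.mapDomain_apply (act_injective k hρ)]

/-- A bound for the column indices occurring in `a`. -/
def bd {k : ℕ} (a : Fin k × ℕ →₀ ℕ) : ℕ := a.support.sup fun p => p.2 + 1

/-- The word of columns of `a`. -/
def word {k : ℕ} (a : Fin k × ℕ →₀ ℕ) : List (Fin k → ℕ) :=
  (List.range (bd a)).map fun j i => a (i, j)

lemma lt_bd {k : ℕ} {a : Fin k × ℕ →₀ ℕ} {p : Fin k × ℕ} (h : a p ≠ 0) : p.2 < bd a :=
  Finset.le_sup (f := fun p : Fin k × ℕ => p.2 + 1) (Finsupp.mem_support_iff.2 h)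

lemma of_word {k : ℕ} {a b : Fin k × ℕ →₀ ℕ}
    (h : List.SublistForall₂ (· ≤ ·) (word a) (word b)) :
    ∃ ρ : ℕ → ℕ, StrictMono ρ ∧ a.mapDomain (act k ρ) ≤ b := by
  obtain ⟨l, h1, h2⟩ := List.sublistForall₂_iff.1 h
  obtain ⟨f, hf⟩ := List.sublist_iff_exists_orderEmbedding_getElem?_eq.1 h2
  refine ⟨f, f.strictMono, fun p => ?_⟩
  by_cases hr : p ∈ Set.range (act k f)
  · obtain ⟨p, rfl⟩ := hr
    rw [Finsupp.mapDomain_apply (act_injective k f.strictMono)]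
    by_cases h0 : a p = 0
    · simp [h0]
    have hp := lt_bd h0
    obtain ⟨hlen, hget⟩ := List.forall₂_iff_get.1 h1
    have ha : p.2 < (word a).length := by simpa [word] using hp
    have hl : p.2 < l.length := hlen ▸ ha
    have h3 := hget p.2 ha hl p.1
    have h4 := hf p.2
    rw [List.getElem?_eq_getElem hl] at h4
    obtain ⟨hb, h5⟩ := List.getElem?_eq_some_iff.1 h4.symm
    simp only [List.get_eq_getElem, ← h5] at h3
    have e1 : (word a)[p.2] = fun i => a (i, p.2) := by simp [word]
    have e2 : (word b)[f p.2] = fun i => b (i, f p.2) := by simp [word]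
    rw [e1, e2] at h3
    exact h3
  · rw [Finsupp.mapDomain_of_notMem_range _ _ hr]
    exact Nat.zero_le _

lemma wqo {k : ℕ} (g : ℕ → (Fin k × ℕ →₀ ℕ)) :
    ∃ m n, m < n ∧ ∃ ρ : ℕ → ℕ, StrictMono ρ ∧ (g m).mapDomain (act k ρ) ≤ g n := by
  have h := Set.PartiallyWellOrderedOn.partiallyWellOrderedOn_sublistForall₂
    (· ≤ ·) (Set.isPWO_of_wellQuasiOrderedLE (Set.univ : Set (Fin k → ℕ)))
  obtain ⟨m, n, hmn, hs⟩ := h.exists_lt (f := fun n => word (g n)) (by simp)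
  exact ⟨m, n, hmn, of_word hs⟩

theorem main (K : Type*) [Field K] (k : ℕ)
    (I : Ideal (MvPolynomial (Fin k × ℕ) K))
    (hI : ∀ ρ : ℕ → ℕ, StrictMono ρ → ∀ f ∈ I, rename (act k ρ) f ∈ I) :
    ∃ F : Finset (MvPolynomial (Fin k × ℕ) K), (↑F : Set (MvPolynomial (Fin k × ℕ) K)) ⊆ I ∧
      I = Ideal.span {g | ∃ (ρ : ℕ → ℕ) (f : MvPolynomial (Fin k × ℕ) K),
        StrictMono ρ ∧ f ∈ F ∧ g = rename (act k ρ) f} := by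
  classical
  set m := incOrder k with hm
  obtain ⟨F, hF, hb⟩ : ∃ F : Finset (MvPolynomial (Fin k × ℕ) K), (∀ f ∈ F, f ∈ I ∧ f ≠ 0) ∧
      ∀ f, (f ∈ I ∧ f ≠ 0) → ∃ g ∈ F, ∃ ρ : ℕ → ℕ, StrictMono ρ ∧
        (m.degree g).mapDomain (act k ρ) ≤ m.degree f := by
    by_contra! hcon
    obtain ⟨s, -, hs⟩ := exists_seq_of_forall_finset_exists
      (fun f : MvPolynomial (Fin k × ℕ) K => f ∈ I ∧ f ≠ 0)
      (fun g f => ∀ ρ : ℕ → ℕ, StrictMono ρ →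
        ¬ (m.degree g).mapDomain (act k ρ) ≤ m.degree f) hcon
    obtain ⟨i, j, hij, ρ, hρ, hle⟩ := wqo fun n => m.degree (s n)
    exact hs i j hij ρ hρ hle
  refine ⟨F, fun f hf => (hF f hf).1, le_antisymm ?_ ?_⟩
  swap
  · rw [Ideal.span_le]
    rintro _ ⟨ρ, f, hρ, hf, rfl⟩
    exact hI ρ hρ f (hF f hf).1
  set J := Ideal.span {g | ∃ (ρ : ℕ → ℕ) (f : MvPolynomial (Fin k × ℕ) K),
        StrictMono ρ ∧ f ∈ F ∧ g = rename (act k ρ) f} with hJ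
  have key : ∀ d : m.syn, ∀ f ∈ I, m.toSyn (m.degree f) = d → f ∈ J := by
    intro d
    induction d using WellFoundedLT.induction with
    | ind d ih =>
    intro f hf hd
    by_cases hf0 : f = 0
    · rw [hf0]; exact J.zero_mem
    obtain ⟨g, hg, ρ, hρ, hle⟩ := hb f ⟨hf, hf0⟩
    obtain ⟨hgI, hg0⟩ := hF g hg
    have hinj := act_injective k hρ
    set h := rename (act k ρ) g with hh
    have hh0 : h ≠ 0 := by
      intro h0
      exact hg0 (rename_injective _ hinj (by rw [← hh, h0, map_zero]))
    have hhJ : h ∈ J := Ideal.subset_span ⟨ρ, g, hρ, hg, rfl⟩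
    have hhI : h ∈ I := hI ρ hρ g hgI
    have hdeg : m.degree h = (m.degree g).mapDomain (act k ρ) := by
      apply m.toSyn.injective
      apply le_antisymm
      · rw [MonomialOrder.degree_le_iff]
        intro c hc
        rw [hh, support_rename_of_injective hinj, Finset.mem_image] at hc
        obtain ⟨c, hc, rfl⟩ := hc
        rcases (m.le_degree hc).lt_or_eq with hlt | heq
        · exact (incOrder_mapDomain hρ hlt).le
        · rw [m.toSyn.injective heq]
      · apply m.le_degree
        rw [mem_support_iff, hh, coeff_rename_mapDomain _ hinj]
        exact m.leadingCoeff_ne_zero_iff.2 hg0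
    set c := m.leadingCoeff f / m.leadingCoeff h with hc
    have hc0 : c ≠ 0 := div_ne_zero (m.leadingCoeff_ne_zero_iff.2 hf0)
      (m.leadingCoeff_ne_zero_iff.2 hh0)
    set q := monomial (m.degree f - m.degree h) c * h with hq
    have hmon0 : monomial (m.degree f - m.degree h) c ≠ 0 := by simpa using hc0
    have hqd : m.degree q = m.degree f := by
      rw [hq, m.degree_mul hmon0 hh0, m.degree_monomial, if_neg hc0]
      exact tsub_add_cancel_of_le (hdeg ▸ hle)
    have hql : m.leadingCoeff q = m.leadingCoeff f := by
      rw [hq, m.leadingCoeff_mul, m.leadingCoeff_monomial, hc,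
        div_mul_cancel₀ _ (m.leadingCoeff_ne_zero_iff.2 hh0)]
    have hqJ : q ∈ J := J.mul_mem_left _ hhJ
    have hqI : q ∈ I := I.mul_mem_left _ hhI
    suffices f - q ∈ J by simpa using J.add_mem this hqJ
    by_cases hz : f - q = 0
    · rw [hz]; exact J.zero_mem
    refine ih (m.toSyn (m.degree (f - q))) ?_ _ (I.sub_mem hf hqI) rfl
    rw [← hd]
    have hle' : m.toSyn (m.degree (f - q)) ≤ m.toSyn (m.degree f) := by
      refine m.degree_sub_le.trans ?_
      rw [hqd, sup_idem]
    refine lt_of_le_of_ne hle' fun he => ?_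
    have he := m.toSyn.injective he
    apply m.coeff_degree_ne_zero_iff.2 hz
    rw [he, coeff_sub, sub_eq_zero]
    have := hql
    unfold MonomialOrder.leadingCoeff at this
    rw [hqd] at this
    exact this.symm
  exact fun f hf => key _ f hf rfl

end IncNoeth

/-- (Hillar–Sullivant) The ring `K[x_{ij} : i ∈ {1,…,k}, j ∈ ℕ]` is `Inc(ℕ)`-Noetherian:
every ideal invariant under all strictly increasing maps on the second index is
generated by the `Inc(ℕ)`-orbits of finitely many of its elements. -/
theorem inc_noetherian (K : Type*) [Field K] (k : ℕ) (hk : 1 ≤ k)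
    (I : Ideal (MvPolynomial (Fin k × ℕ) K))
    (hI : ∀ ρ : ℕ → ℕ, StrictMono ρ →
      ∀ f ∈ I, rename (fun p : Fin k × ℕ => (p.1, ρ p.2)) f ∈ I) :
    ∃ F : Finset (MvPolynomial (Fin k × ℕ) K), (↑F : Set (MvPolynomial (Fin k × ℕ) K)) ⊆ I ∧
      I = Ideal.span {g | ∃ (ρ : ℕ → ℕ) (f : MvPolynomial (Fin k × ℕ) K),
        StrictMono ρ ∧ f ∈ F ∧ g = rename (fun p : Fin k × ℕ => (p.1, ρ p.2)) f} := by
  exact IncNoeth.main K k I hI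
end

section
/- Let K be a field and k ≥ 1. The polynomial ring K[x_{ij} : i ∈ {1,…,k}, j ∈ ℕ] is S_∞-Noetherian: for every ideal I that is invariant under all finitary permutations σ of ℕ acting by x_{ij} ↦ x_{iσ(j)}, there exists a finite subset F ⊆ I such that I is generated as an ideal by { σ·f : σ a finitary permutation of ℕ, f ∈ F }. -/
open MvPolynomial

namespace SInfNoeth

/-- The reindexing `(i, j) ↦ (j, i)` into the dual of the lexicographic product. -/
def ix (k : ℕ) : Fin k × ℕ ≃ (ℕ ×ₗ Fin k)ᵒᵈ :=
  (Equiv.prodComm _ _).trans (toLex.trans OrderDual.toDual)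

/-- Lexicographic order on monomials in which variables of larger column index dominate. -/
noncomputable def ord (k : ℕ) : MonomialOrder (Fin k × ℕ) where
  syn := (MonomialOrder.lex (σ := (ℕ ×ₗ Fin k)ᵒᵈ)).syn
  toSyn := (Finsupp.domCongr (ix k)).trans
    (MonomialOrder.lex (σ := (ℕ ×ₗ Fin k)ᵒᵈ)).toSyn
  toSyn_monotone := by
    intro a b hab
    have h : Finsupp.domCongr (ix k) a ≤ Finsupp.domCongr (ix k) b := by
      intro q
      simpa using hab _
    exact (MonomialOrder.lex (σ := (ℕ ×ₗ Fin k)ᵒᵈ)).toSyn_monotone h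

/-- The order on variables. -/
def vlt {k : ℕ} (p q : Fin k × ℕ) : Prop := p.2 < q.2 ∨ (p.2 = q.2 ∧ p.1 < q.1)

theorem ix_lt {k : ℕ} (p q : Fin k × ℕ) : ix k p < ix k q ↔ vlt q p := by
  change toLex (q.2, q.1) < toLex (p.2, p.1) ↔ _
  rw [Prod.Lex.toLex_lt_toLex]
  rfl

theorem ord_lt {k : ℕ} (a b : Fin k × ℕ →₀ ℕ) :
    (ord k).toSyn a < (ord k).toSyn b ↔ ∃ p, (∀ q, vlt p q → a q = b q) ∧ a p < b p := by
  change toLex (Finsupp.domCongr (ix k) a) < toLex (Finsupp.domCongr (ix k) b) ↔ _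
  rw [Finsupp.Lex.lt_iff, ← (ix k).exists_congr_right]
  refine exists_congr fun p => ?_
  rw [← (ix k).forall_congr_right]
  simp [ix_lt]

/-- The action of a map of `ℕ` on indices. -/
def act (k : ℕ) (π : ℕ → ℕ) : Fin k × ℕ → Fin k × ℕ := fun p => (p.1, π p.2)

theorem act_inj {k : ℕ} {π : ℕ → ℕ} (h : Function.Injective π) :
    Function.Injective (act k π) := by
  rintro ⟨a, b⟩ ⟨c, d⟩ h'
  simp only [act, Prod.mk.injEq] at h'
  rw [h'.1, h h'.2]

theorem ord_mapDomain_lt {k : ℕ} {π : ℕ → ℕ} (h : StrictMono π) {a b : Fin k × ℕ →₀ ℕ}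
    (hab : (ord k).toSyn a < (ord k).toSyn b) :
    (ord k).toSyn (a.mapDomain (act k π)) < (ord k).toSyn (b.mapDomain (act k π)) := by
  rw [ord_lt] at hab ⊢
  obtain ⟨p, hp, hlt⟩ := hab
  have hi := act_inj (k := k) h.injective
  refine ⟨act k π p, fun q hq => ?_, ?_⟩
  · by_cases hr : q ∈ Set.range (act k π)
    · obtain ⟨q, rfl⟩ := hr
      rw [Finsupp.mapDomain_apply hi, Finsupp.mapDomain_apply hi]
      apply hp
      simpa [vlt, act, h.lt_iff_lt, h.injective.eq_iff] using hq
    · rw [Finsupp.mapDomain_of_notMem_range _ _ hr, Finsupp.mapDomain_of_notMem_range _ _ hr]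
  · rwa [Finsupp.mapDomain_apply hi, Finsupp.mapDomain_apply hi]

theorem ord_mapDomain_le {k : ℕ} {π : ℕ → ℕ} (h : StrictMono π) {a b : Fin k × ℕ →₀ ℕ}
    (hab : (ord k).toSyn a ≤ (ord k).toSyn b) :
    (ord k).toSyn (a.mapDomain (act k π)) ≤ (ord k).toSyn (b.mapDomain (act k π)) := by
  rcases hab.lt_or_eq with hlt | heq
  · exact (ord_mapDomain_lt h hlt).le
  · rw [(ord k).toSyn.injective heq]

theorem degree_rename {K : Type*} [Field K] {k : ℕ} {π : ℕ → ℕ} (h : StrictMono π)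
    {f : MvPolynomial (Fin k × ℕ) K} (hf : f ≠ 0) :
    (ord k).degree (rename (act k π) f) = ((ord k).degree f).mapDomain (act k π) := by
  classical
  have hs := support_rename_of_injective (p := f) (act_inj (k := k) h.injective)
  apply (ord k).toSyn.injective
  apply le_antisymm
  · rw [MonomialOrder.degree_le_iff]
    intro d hd
    rw [hs, Finset.mem_image] at hd
    obtain ⟨c, hc, rfl⟩ := hd
    exact ord_mapDomain_le h ((ord k).le_degree hc)
  · apply (ord k).le_degree
    rw [hs]
    exact Finset.mem_image_of_mem _ ((ord k).degree_mem_support hf)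

/-- The embedding quasi-order on monomials. -/
def R {k : ℕ} (u v : Fin k × ℕ →₀ ℕ) : Prop :=
  ∃ π : ℕ → ℕ, StrictMono π ∧ u.mapDomain (act k π) ≤ v

theorem exists_bound {k : ℕ} (s : Finset (Fin k × ℕ)) : ∃ N, ∀ p ∈ s, p.2 < N :=
  ⟨s.sup Prod.snd + 1, fun _ hp => Nat.lt_succ_of_le (Finset.le_sup (f := Prod.snd) hp)⟩

/-- The word of columns of a monomial. -/
def word {k : ℕ} (u : Fin k × ℕ →₀ ℕ) (N : ℕ) : List (Fin k → ℕ) :=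
  (List.range N).map fun j i => u (i, j)

theorem word_get {k : ℕ} (u : Fin k × ℕ →₀ ℕ) (N j : ℕ) (h : j < (word u N).length) :
    (word u N)[j] = fun i => u (i, j) := by
  unfold word at h ⊢
  rw [List.getElem_map, List.getElem_range]

theorem R_of_sublist {k : ℕ} {u v : Fin k × ℕ →₀ ℕ} {N M : ℕ}
    (hu : ∀ p ∈ u.support, p.2 < N)
    (h : List.SublistForall₂ (· ≤ ·) (word u N) (word v M)) : R u v := by
  obtain ⟨l, hl, hsub⟩ := List.sublistForall₂_iff.1 h
  obtain ⟨π, hπ⟩ := List.sublist_iff_exists_orderEmbedding_getElem?_eq.1 hsub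
  refine ⟨π, π.strictMono, fun q => ?_⟩
  by_cases hr : q ∈ Set.range (act k π)
  · obtain ⟨⟨i, j⟩, rfl⟩ := hr
    rw [Finsupp.mapDomain_apply (act_inj π.injective)]
    by_cases h0 : u (i, j) = 0
    · simp [h0]
    have hj : j < N := hu (i, j) (by simpa using h0)
    have hlen := hl.length_eq
    have hjl : j < l.length := by rw [← hlen]; simpa [word] using hj
    have h1 := (List.forall₂_iff_get.1 hl).2 j (by simpa [word] using hj) hjl
    have h2 := hπ j
    rw [List.getElem?_eq_getElem hjl] at h2
    obtain ⟨hm, he⟩ := List.getElem?_eq_some_iff.1 h2.symm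
    simp only [List.get_eq_getElem, ← he] at h1
    have h3 := h1 i
    rw [word_get, word_get] at h3
    exact h3
  · rw [Finsupp.mapDomain_of_notMem_range _ _ hr]
    exact Nat.zero_le _

theorem R_wqo {k : ℕ} (f : ℕ → (Fin k × ℕ →₀ ℕ)) : ∃ m n, m < n ∧ R (f m) (f n) := by
  choose N hN using fun n => exists_bound (f n).support
  have h1 : (Set.univ : Set (Fin k → ℕ)).PartiallyWellOrderedOn (· ≤ ·) :=
    Set.isPWO_of_wellQuasiOrderedLE _
  have h2 := Set.PartiallyWellOrderedOn.partiallyWellOrderedOn_sublistForall₂ _ h1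
  obtain ⟨m, n, hmn, h⟩ := h2.exists_lt (f := fun n => word (f n) (N n)) (by simp)
  exact ⟨m, n, hmn, R_of_sublist (hN m) h⟩

theorem exists_perm {π : ℕ → ℕ} (h : Function.Injective π) (N : ℕ) :
    ∃ σ : Equiv.Perm ℕ, {n | σ n ≠ n}.Finite ∧ ∀ j < N, σ j = π j := by
  induction N with
  | zero => exact ⟨1, by simp, by simp⟩
  | succ N ih =>
    obtain ⟨σ, hf, hσ⟩ := ih
    refine ⟨σ.trans (Equiv.swap (σ N) (π N)), ?_, fun j hj => ?_⟩
    · refine (hf.union (Set.toFinite {σ N, π N})).subset fun n hn => ?_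
      by_contra hc
      simp only [Set.mem_union, Set.mem_ofPred_eq, Set.mem_insert_iff, Set.mem_singleton_iff,
        not_or, not_not] at hc
      apply hn
      rw [Equiv.trans_apply, hc.1, Equiv.swap_apply_of_ne_of_ne hc.2.1 hc.2.2]
    · rw [Equiv.trans_apply]
      rcases Nat.lt_succ_iff_lt_or_eq.1 hj with hlt | rfl
      · rw [Equiv.swap_apply_of_ne_of_ne, hσ j hlt]
        · exact fun e => hlt.ne (σ.injective e)
        · rw [hσ j hlt]
          exact fun e => hlt.ne (h e)
      · rw [Equiv.swap_apply_left]

theorem exists_perm_rename {K : Type*} [Field K] {k : ℕ} {π : ℕ → ℕ}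
    (h : Function.Injective π) (f : MvPolynomial (Fin k × ℕ) K) :
    ∃ σ : Equiv.Perm ℕ, {n | σ n ≠ n}.Finite ∧
      rename (act k π) f = rename (act k σ) f := by
  obtain ⟨N, hN⟩ := exists_bound f.vars
  obtain ⟨σ, hf, hσ⟩ := exists_perm h N
  refine ⟨σ, hf, ?_⟩
  rw [rename_eq_aeval, rename_eq_aeval]
  refine eval₂Hom_congr' rfl ?_ rfl
  intro p hp _
  simp [act, hσ _ (hN p hp)]

theorem exists_basis {K : Type*} [Field K] {k : ℕ} (I : Ideal (MvPolynomial (Fin k × ℕ) K)) :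
    ∃ F : Finset (MvPolynomial (Fin k × ℕ) K), (∀ f ∈ F, f ∈ I ∧ f ≠ 0) ∧
      ∀ g ∈ I, g ≠ 0 → ∃ f ∈ F, R ((ord k).degree f) ((ord k).degree g) := by
  by_contra! hc
  obtain ⟨f, -, hf⟩ := exists_seq_of_forall_finset_exists
    (fun f : MvPolynomial (Fin k × ℕ) K => f ∈ I ∧ f ≠ 0)
    (fun f g => ¬ R ((ord k).degree f) ((ord k).degree g))
    (fun s hs => by
      obtain ⟨g, hg, hg0, h⟩ := hc s hs
      exact ⟨g, ⟨hg, hg0⟩, h⟩)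
  obtain ⟨m, n, hmn, h⟩ := R_wqo fun n => (ord k).degree (f n)
  exact hf m n hmn h

theorem mem_of_basis {K : Type*} [Field K] {k : ℕ} (I J : Ideal (MvPolynomial (Fin k × ℕ) K))
    (hJI : J ≤ I)
    (h : ∀ g ∈ I, g ≠ 0 → ∃ p ∈ J, p ≠ 0 ∧ (ord k).degree p ≤ (ord k).degree g) :
    ∀ g ∈ I, g ∈ J := by
  intro g
  induction hd : (ord k).toSyn ((ord k).degree g) using WellFoundedLT.induction
    generalizing g with
  | ind d ih =>
    intro hg
    by_cases hg0 : g = 0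
    · rw [hg0]; exact J.zero_mem
    obtain ⟨p, hp, hp0, hle⟩ := h g hg hg0
    have hu : IsUnit ((ord k).leadingCoeff p) :=
      isUnit_iff_ne_zero.2 (MonomialOrder.leadingCoeff_ne_zero_iff.2 hp0)
    by_cases hz : (ord k).degree g = 0
    · have hpz : (ord k).degree p = 0 := le_antisymm (hz ▸ hle) zero_le
      have e := MonomialOrder.eq_C_of_degree_eq_zero hpz
      have hJ : J = ⊤ := by
        apply Ideal.eq_top_of_isUnit_mem J hp
        rw [e]
        exact hu.map C
      rw [hJ]; trivial
    · have hlt := MonomialOrder.degree_reduce_lt hu hle hz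
      have hmul : monomial ((ord k).degree g - (ord k).degree p)
          (hu.unit⁻¹ * (ord k).leadingCoeff g) * p ∈ J := J.mul_mem_left _ hp
      have hr := ih _ (hd ▸ hlt) ((ord k).reduce hu g) rfl (I.sub_mem hg (hJI hmul))
      have := J.add_mem hr hmul
      rwa [MonomialOrder.reduce, sub_add_cancel] at this

end SInfNoeth

/-- The ring `K[x_{ij} : i ∈ {1,…,k}, j ∈ ℕ]` is `S_∞`-Noetherian: every ideal
invariant under all finitary permutations of the second index is generated by the
`S_∞`-orbits of finitely many of its elements. -/
theorem sInf_noetherian (K : Type*) [Field K] (k : ℕ) (hk : 1 ≤ k)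
    (I : Ideal (MvPolynomial (Fin k × ℕ) K))
    (hI : ∀ σ : Equiv.Perm ℕ, {n | σ n ≠ n}.Finite →
      ∀ f ∈ I, rename (fun p : Fin k × ℕ => (p.1, σ p.2)) f ∈ I) :
    ∃ F : Finset (MvPolynomial (Fin k × ℕ) K), (↑F : Set (MvPolynomial (Fin k × ℕ) K)) ⊆ I ∧
      I = Ideal.span {g | ∃ (σ : Equiv.Perm ℕ) (f : MvPolynomial (Fin k × ℕ) K),
        {n | σ n ≠ n}.Finite ∧ f ∈ F ∧ g = rename (fun p : Fin k × ℕ => (p.1, σ p.2)) f} := by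
  obtain ⟨F, hF, hb⟩ := SInfNoeth.exists_basis I
  refine ⟨F, fun f hf => (hF f hf).1, ?_⟩
  have hJI : Ideal.span {g | ∃ (σ : Equiv.Perm ℕ) (f : MvPolynomial (Fin k × ℕ) K),
      {n | σ n ≠ n}.Finite ∧ f ∈ F ∧
        g = rename (fun p : Fin k × ℕ => (p.1, σ p.2)) f} ≤ I := by
    rw [Ideal.span_le]
    rintro g ⟨σ, f, hσ, hf, rfl⟩
    exact hI σ hσ f (hF f hf).1
  refine le_antisymm (SInfNoeth.mem_of_basis I _ hJI fun g hg hg0 => ?_) hJI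
  obtain ⟨f, hf, π, hπ, hle⟩ := hb g hg hg0
  obtain ⟨σ, hσ, he⟩ := SInfNoeth.exists_perm_rename hπ.injective f
  refine ⟨rename (SInfNoeth.act k π) f, Ideal.subset_span ⟨σ, f, hσ, hf, he⟩, ?_, ?_⟩
  · intro h0
    exact (hF f hf).2 (rename_injective _ (SInfNoeth.act_inj hπ.injective) (by rw [h0, map_zero]))
  · rwa [SInfNoeth.degree_rename hπ (hF f hf).2]
end

section
/- Let K be a field, k ≥ 1, and R = K[x_{ij} : i ∈ {1,…,k}, j ∈ ℕ]. Let ≤ be an Inc(ℕ)-respecting monomial order on the monomials of R: a linear order on the free commutative monoid of monomials that is a well-order, satisfies m ≤ m' ⟹ m·q ≤ m'·q for all monomials q, and satisfies m ≤ m' ⟹ ρ·m ≤ ρ·m' for all ρ ∈ Inc(ℕ). Then every Inc(ℕ)-invariant ideal I ⊆ R has a finite Inc(ℕ)-equivariant Gröbner basis: there is a finite set G ⊆ I such that the ideal generated by the leading monomials lm(ρ·g), for ρ ∈ Inc(ℕ) and g ∈ G, equals the ideal generated by the leading monomials lm(f) of all nonzero f ∈ I. -/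
open MvPolynomial

/-- The leading monomial (exponent vector) of a polynomial with respect to a linear
order `r` on monomials: the `r`-largest element of the support (and `0` for the
zero polynomial). -/
noncomputable def leadMon {σ K : Type*} [CommSemiring K]
    (r : LinearOrder (σ →₀ ℕ)) (f : MvPolynomial σ K) : σ →₀ ℕ :=
  if h : f.support.Nonempty then @Finset.max' _ r f.support h else 0

/-- Higman embedding of words turned into a strictly increasing map. -/
theorem exists_strictMono_of_sublistForall {k : ℕ} {l₁ l₂ : List (Fin k → ℕ)}
    (h : List.SublistForall₂ (· ≤ ·) l₁ l₂) :
    ∃ ρ : ℕ → ℕ, StrictMono ρ ∧ ∀ i, l₁.getD i 0 ≤ l₂.getD (ρ i) 0 := by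
  induction h with
  | nil => exact ⟨id, strictMono_id, fun i => by simp [Pi.le_def]⟩
  | cons hab _ ih =>
    obtain ⟨ρ, hρ, hle⟩ := ih
    refine ⟨fun i => Nat.casesOn i 0 (fun j => ρ j + 1), ?_, ?_⟩
    · refine strictMono_nat_of_lt_succ fun n => ?_
      cases n with
      | zero => simp
      | succ n => simpa using hρ (Nat.lt_succ_self n)
    · intro i
      cases i with
      | zero => simpa using hab
      | succ n => simpa using hle n
  | cons_right _ ih =>
    obtain ⟨ρ, hρ, hle⟩ := ih
    exact ⟨fun i => ρ i + 1, fun a b hab => by simpa using hρ hab, fun i => by simpa using hle i⟩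

/-- The word of a monomial. -/
noncomputable def monWord {k : ℕ} (m : (Fin k × ℕ) →₀ ℕ) : List (Fin k → ℕ) :=
  (List.range (m.support.sup (fun p => p.2) + 1)).map (fun j i => m (i, j))

theorem monWord_getD {k : ℕ} (m : (Fin k × ℕ) →₀ ℕ) (i : Fin k) (j : ℕ) :
    (monWord m).getD j 0 i = m (i, j) := by
  unfold monWord
  by_cases hj : j < m.support.sup (fun p => p.2) + 1
  · simp [List.getD_eq_getElem?_getD, hj]
  · rw [List.getD_eq_default _ _ (by simpa using hj)]
    by_contra hne
    have hmem : (i, j) ∈ m.support := by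
      rw [Finsupp.mem_support_iff]; exact fun h => hne (by simp [h])
    have := Finset.le_sup (f := fun p : Fin k × ℕ => p.2) hmem
    simp only at this
    omega

theorem shift_injective {k : ℕ} {ρ : ℕ → ℕ} (hρ : StrictMono ρ) :
    Function.Injective (fun p : Fin k × ℕ => (p.1, ρ p.2)) := by
  rintro ⟨a, b⟩ ⟨c, d⟩ h
  simp only [Prod.mk.injEq] at h
  exact Prod.ext h.1 (hρ.injective h.2)

/-- Divisibility up to increasing maps has no bad sequences. -/
theorem exists_shift_le {k : ℕ} (f : ℕ → ((Fin k × ℕ) →₀ ℕ)) :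
    ∃ m n, m < n ∧ ∃ ρ : ℕ → ℕ, StrictMono ρ ∧
      Finsupp.mapDomain (fun p : Fin k × ℕ => (p.1, ρ p.2)) (f m) ≤ f n := by
  have hp : (Set.univ : Set (Fin k → ℕ)).PartiallyWellOrderedOn (· ≤ ·) :=
    Set.isPWO_of_wellQuasiOrderedLE _
  have hH := Set.PartiallyWellOrderedOn.partiallyWellOrderedOn_sublistForall₂ (· ≤ ·) hp
  obtain ⟨m, n, hmn, hs⟩ := hH (fun n => ⟨monWord (f n), by simp⟩)
  obtain ⟨ρ, hρ, hle⟩ := exists_strictMono_of_sublistForall hs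
  refine ⟨m, n, hmn, ρ, hρ, ?_⟩
  intro q
  by_cases hq : q ∈ Set.range (fun p : Fin k × ℕ => (p.1, ρ p.2))
  · obtain ⟨p, rfl⟩ := hq
    rw [Finsupp.mapDomain_apply (shift_injective hρ)]
    have := hle p.2 p.1
    rw [monWord_getD, monWord_getD] at this
    exact this
  · rw [Finsupp.mapDomain_notin_range _ _ hq]
    exact Nat.zero_le _

theorem leadMon_mem {σ K : Type*} [CommSemiring K] (r : LinearOrder (σ →₀ ℕ))
    {f : MvPolynomial σ K} (hf : f ≠ 0) : leadMon r f ∈ f.support := by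
  have h : f.support.Nonempty := by simpa [Finset.nonempty_iff_ne_empty] using hf
  rw [leadMon, dif_pos h]
  exact @Finset.max'_mem _ r _ h

theorem le_leadMon {σ K : Type*} [CommSemiring K] (r : LinearOrder (σ →₀ ℕ))
    {f : MvPolynomial σ K} {a : σ →₀ ℕ} (ha : a ∈ f.support) : r.le a (leadMon r f) := by
  rw [leadMon, dif_pos ⟨a, ha⟩]
  exact @Finset.le_max' _ r _ _ ha

theorem leadMon_rename {σ K : Type*} [CommSemiring K] (r : LinearOrder (σ →₀ ℕ))
    (e : σ → σ) (he : Function.Injective e)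
    (hinc : ∀ a b : σ →₀ ℕ, r.le a b → r.le (Finsupp.mapDomain e a) (Finsupp.mapDomain e b))
    {f : MvPolynomial σ K} (hf : f ≠ 0) :
    leadMon r (rename e f) = Finsupp.mapDomain e (leadMon r f) := by
  classical
  have hs := support_rename_of_injective (p := f) he
  have hne : rename e f ≠ 0 := by
    intro h
    exact hf (rename_injective e he (by simpa using h))
  apply r.le_antisymm
  · have h := leadMon_mem r hne
    rw [hs, Finset.mem_image] at h
    obtain ⟨a, ha, hae⟩ := h
    rw [← hae]
    exact hinc _ _ (le_leadMon r ha)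
  · apply le_leadMon
    rw [hs]
    exact Finset.mem_image_of_mem _ (leadMon_mem r hf)

/-- If `≤` is an `Inc(ℕ)`-respecting monomial order on the monomials of
`K[x_{ij} : i ∈ {1,…,k}, j ∈ ℕ]`, then every `Inc(ℕ)`-invariant ideal has a finite
`Inc(ℕ)`-equivariant Gröbner basis `G`: the leading monomials of the `Inc(ℕ)`-orbit
of `G` generate the same ideal as the leading monomials of all nonzero elements
of `I`. -/
theorem finite_equivariant_groebner_basis (K : Type*) [Field K] (k : ℕ) (hk : 1 ≤ k)
    (r : LinearOrder ((Fin k × ℕ) →₀ ℕ)) (hwo : WellFounded r.lt)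
    (hmul : ∀ a b c : (Fin k × ℕ) →₀ ℕ, r.le a b → r.le (a + c) (b + c))
    (hinc : ∀ (ρ : ℕ → ℕ), StrictMono ρ → ∀ a b : (Fin k × ℕ) →₀ ℕ, r.le a b →
      r.le (Finsupp.mapDomain (fun p : Fin k × ℕ => (p.1, ρ p.2)) a)
           (Finsupp.mapDomain (fun p : Fin k × ℕ => (p.1, ρ p.2)) b))
    (I : Ideal (MvPolynomial (Fin k × ℕ) K))
    (hI : ∀ ρ : ℕ → ℕ, StrictMono ρ →
      ∀ f ∈ I, rename (fun p : Fin k × ℕ => (p.1, ρ p.2)) f ∈ I) :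
    ∃ G : Finset (MvPolynomial (Fin k × ℕ) K),
      (↑G : Set (MvPolynomial (Fin k × ℕ) K)) ⊆ I ∧ (0 : MvPolynomial (Fin k × ℕ) K) ∉ G ∧
      Ideal.span {p : MvPolynomial (Fin k × ℕ) K | ∃ (ρ : ℕ → ℕ)
          (g : MvPolynomial (Fin k × ℕ) K), StrictMono ρ ∧ g ∈ G ∧
          p = monomial (leadMon r (rename (fun q : Fin k × ℕ => (q.1, ρ q.2)) g)) (1 : K)} =
        Ideal.span {p : MvPolynomial (Fin k × ℕ) K | ∃ f ∈ I, f ≠ 0 ∧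
          p = monomial (leadMon r f) (1 : K)} := by
  classical
  have key : ∃ G : Finset (MvPolynomial (Fin k × ℕ) K), (∀ g ∈ G, g ∈ I ∧ g ≠ 0) ∧
      ∀ f, f ∈ I ∧ f ≠ 0 → ∃ g ∈ G, ∃ ρ : ℕ → ℕ, StrictMono ρ ∧
        Finsupp.mapDomain (fun p : Fin k × ℕ => (p.1, ρ p.2)) (leadMon r g) ≤ leadMon r f := by
    by_contra hcon
    push Not at hcon
    obtain ⟨F, hF, hbad⟩ := exists_seq_of_forall_finset_exists
      (fun f : MvPolynomial (Fin k × ℕ) K => f ∈ I ∧ f ≠ 0)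
      (fun g f => ∀ ρ : ℕ → ℕ, StrictMono ρ →
        ¬ Finsupp.mapDomain (fun p : Fin k × ℕ => (p.1, ρ p.2)) (leadMon r g) ≤ leadMon r f)
      (fun s hs => by
        obtain ⟨f, hf, hfb⟩ := hcon s hs
        exact ⟨f, hf, hfb⟩)
    obtain ⟨m, n, hmn, ρ, hρ, hle⟩ := exists_shift_le (fun n => leadMon r (F n))
    exact hbad m n hmn ρ hρ hle
  obtain ⟨G, hG, hdiv⟩ := key
  refine ⟨G, fun g hg => (hG g hg).1, fun h => (hG 0 h).2 rfl, le_antisymm ?_ ?_⟩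
  · rw [Ideal.span_le]
    rintro p ⟨ρ, g, hρ, hg, rfl⟩
    refine Ideal.subset_span ⟨_, hI ρ hρ g (hG g hg).1, ?_, rfl⟩
    intro h
    exact (hG g hg).2 (rename_injective _ (shift_injective hρ) (by simpa using h))
  · rw [Ideal.span_le]
    rintro p ⟨f, hf, hf0, rfl⟩
    obtain ⟨g, hg, ρ, hρ, hle⟩ := hdiv f ⟨hf, hf0⟩
    rw [← leadMon_rename r _ (shift_injective hρ) (hinc ρ hρ) (hG g hg).2] at hle
    obtain ⟨c, hc⟩ := exists_add_of_le hle
    have : monomial (leadMon r f) (1 : K) = monomial c 1 * monomial (leadMon r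
        (rename (fun p : Fin k × ℕ => (p.1, ρ p.2)) g)) 1 := by
      rw [monomial_mul, hc, add_comm c, one_mul]
    rw [this]
    exact Ideal.mul_mem_left _ _ (Ideal.subset_span ⟨ρ, g, hρ, hg, rfl⟩)
end

section
/- Let (F_n) denote the Fibonacci sequence with F_1 = F_2 = 1. Then for every natural number n, the identity (F_{3n} − 5·F_n³ − 3·F_n)·(F_{3n} − 5·F_n³ + 3·F_n) = 0 holds in the integers. -/
theorem fib_three_mul_aux (n : ℕ) :
    (Nat.fib (3 * n) : ℤ) = Nat.fib n * (3 * (Nat.fib (n + 1) : ℤ) ^ 2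
        - 3 * Nat.fib n * Nat.fib (n + 1) + 2 * (Nat.fib n : ℤ) ^ 2) ∧
    (Nat.fib (3 * n + 1) : ℤ) = (Nat.fib (n + 1) : ℤ) ^ 3
        + 3 * (Nat.fib n : ℤ) ^ 2 * Nat.fib (n + 1) - (Nat.fib n : ℤ) ^ 3 ∧
    ((Nat.fib (n + 1) : ℤ) ^ 2 - Nat.fib n * Nat.fib (n + 1) - (Nat.fib n : ℤ) ^ 2) ^ 2 = 1 := by
  induction n with
  | zero => simp
  | succ k ih =>
    obtain ⟨h1, h2, h3⟩ := ih
    have e0 : (Nat.fib (k + 1 + 1) : ℤ) = Nat.fib k + Nat.fib (k + 1) := by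
      exact_mod_cast Nat.fib_add_two (n := k)
    have e1 : (Nat.fib (3 * k + 2) : ℤ) = Nat.fib (3 * k) + Nat.fib (3 * k + 1) := by
      exact_mod_cast Nat.fib_add_two (n := 3 * k)
    have e2 : (Nat.fib (3 * k + 3) : ℤ) = Nat.fib (3 * k + 1) + Nat.fib (3 * k + 2) := by
      exact_mod_cast Nat.fib_add_two (n := 3 * k + 1)
    have e3 : (Nat.fib (3 * k + 4) : ℤ) = Nat.fib (3 * k + 2) + Nat.fib (3 * k + 3) := by
      exact_mod_cast Nat.fib_add_two (n := 3 * k + 2)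
    rw [show 3 * (k + 1) + 1 = 3 * k + 4 by ring, show 3 * (k + 1) = 3 * k + 3 by ring,
      e3, e2, e1, e0, h1, h2]
    refine ⟨by ring, by ring, ?_⟩
    rw [← h3]; ring

/-- For every natural number `n`, the Fibonacci identity
`(F_{3n} − 5·F_n³ − 3·F_n)·(F_{3n} − 5·F_n³ + 3·F_n) = 0` holds in the integers. -/
theorem fib_three_mul_identity (n : ℕ) :
    ((Nat.fib (3 * n) : ℤ) - 5 * (Nat.fib n : ℤ) ^ 3 - 3 * (Nat.fib n : ℤ)) *
      ((Nat.fib (3 * n) : ℤ) - 5 * (Nat.fib n : ℤ) ^ 3 + 3 * (Nat.fib n : ℤ)) = 0 := by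
  obtain ⟨h1, -, h3⟩ := fib_three_mul_aux n
  rw [h1]
  linear_combination 9 * (Nat.fib n : ℤ) ^ 2 * h3
end

section
/- Let (F_n) denote the Fibonacci sequence with F_1 = F_2 = 1. Then for every natural number n, the identity (F_{5n} − 25·F_n⁵ − 25·F_n³ − 5·F_n)·(F_{5n} − 25·F_n⁵ + 25·F_n³ − 5·F_n) = 0 holds in the integers. -/
theorem fib_add_int_aux (m n : ℕ) : (Nat.fib (m + n) : ℤ) =
    Nat.fib m * Nat.fib (n + 1) + Nat.fib (m + 1) * Nat.fib n - Nat.fib m * Nat.fib n := by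
  have h1 : (Nat.fib (m + n + 1) : ℤ) =
      Nat.fib m * Nat.fib n + Nat.fib (m + 1) * Nat.fib (n + 1) := by
    exact_mod_cast Nat.fib_add m n
  have h2 : (Nat.fib (m + 1 + n + 1) : ℤ) =
      Nat.fib (m + 1) * Nat.fib n + Nat.fib (m + 2) * Nat.fib (n + 1) := by
    exact_mod_cast Nat.fib_add (m + 1) n
  have h3 : (Nat.fib (m + n + 2) : ℤ) = Nat.fib (m + n) + Nat.fib (m + n + 1) := by
    exact_mod_cast Nat.fib_add_two
  have h4 : (Nat.fib (m + 2) : ℤ) = Nat.fib m + Nat.fib (m + 1) := by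
    exact_mod_cast Nat.fib_add_two
  rw [show m + 1 + n + 1 = m + n + 2 by ring, h4] at h2
  linear_combination h2 - h3 - h1

theorem fib_cassini_aux (n : ℕ) :
    ((Nat.fib (n + 1) : ℤ) ^ 2 - Nat.fib n * Nat.fib (n + 1) - (Nat.fib n : ℤ) ^ 2) ^ 2 = 1 := by
  induction n with
  | zero => simp
  | succ k ih =>
    have h4 : (Nat.fib (k + 1 + 1) : ℤ) = Nat.fib k + Nat.fib (k + 1) := by
      exact_mod_cast Nat.fib_add_two
    rw [h4]
    linear_combination ih


/-- For every natural number `n`, the Fibonacci identity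
`(F_{5n} − 25·F_n⁵ − 25·F_n³ − 5·F_n)·(F_{5n} − 25·F_n⁵ + 25·F_n³ − 5·F_n) = 0`
holds in the integers. -/
theorem fib_five_mul_identity (n : ℕ) :
    ((Nat.fib (5 * n) : ℤ) - 25 * (Nat.fib n : ℤ) ^ 5 - 25 * (Nat.fib n : ℤ) ^ 3
        - 5 * (Nat.fib n : ℤ)) *
      ((Nat.fib (5 * n) : ℤ) - 25 * (Nat.fib n : ℤ) ^ 5 + 25 * (Nat.fib n : ℤ) ^ 3
        - 5 * (Nat.fib n : ℤ)) = 0 := by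
  have he := fib_cassini_aux n
  have f (m : ℕ) := fib_add_int_aux m n
  have g (m : ℕ) : (Nat.fib (m + n + 1) : ℤ) =
      Nat.fib m * Nat.fib n + Nat.fib (m + 1) * Nat.fib (n + 1) := by
    exact_mod_cast Nat.fib_add m n
  have h : (Nat.fib (5 * n) : ℤ) = 25 * (Nat.fib n : ℤ) ^ 5
      + 25 * ((Nat.fib (n + 1) : ℤ) ^ 2 - Nat.fib n * Nat.fib (n + 1) - (Nat.fib n : ℤ) ^ 2)
        * (Nat.fib n : ℤ) ^ 3
      + 5 * ((Nat.fib (n + 1) : ℤ) ^ 2 - Nat.fib n * Nat.fib (n + 1) - (Nat.fib n : ℤ) ^ 2) ^ 2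
        * (Nat.fib n : ℤ) := by
    rw [show 5 * n = n + n + n + n + n by ring]
    rw [f (n + n + n + n), f (n + n + n), g (n + n + n), f (n + n), g (n + n), f n, g n]
    ring
  rw [he] at h
  rw [h]
  linear_combination 625 * (Nat.fib n : ℤ) ^ 6 * he
end
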